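/- Let d ≥ 2 be a natural number and v = (d-2)/2. Suppose g̃ : (1,∞) × [0,∞) → ℝ is continuous, is twice continuously differentiable in the first variable and once continuously differentiable in the second variable on (1,∞) × (0,∞), and satisfies g̃(w,0) = 0 for all w > 1. Suppose further that for every w > 1 and every λ > 0: (i) K_v(√(2λ)) ≠ 0 and ∫₀^∞ e^{-λt} g̃(w,t) dt = w^{d-1-v} · K_v(w√(2λ)) / (λ · K_v(√(2λ))); (ii) the Laplace transforms in t of ∂g̃/∂w, ∂²g̃/∂w², and ∂g̃/∂t exist, and ∫₀^∞ e^{-λt} (∂g̃/∂w)(w,t) dt = ∂/∂w ∫₀^∞ e^{-λt} g̃(w,t) dt, ∫₀^∞ e^{-λt} (∂²g̃/∂w²)(w,t) dt = ∂²/∂w² ∫₀^∞ e^{-λt} g̃(w,t) dt, and ∫₀^∞ e^{-λt} (∂g̃/∂t)(w,t) dt = λ ∫₀^∞ e^{-λt} g̃(w,t) dt. Then g̃ satisfies ∂g̃/∂t (w,t) = (1/2) ∂²g̃/∂w² (w,t) − ((d-1)/(2w)) ∂g̃/∂w (w,t) + ((d-1)/(2w²)) g̃(w,t) for all w > 1 and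 t > 0. -/

import Mathlib

open Real MeasureTheory Set Filter

/-- The modified Bessel function of the second kind for real argument `x > 0`,
defined via the integral representation. -/
noncomputable def besselK (v : ℝ) (x : ℝ) : ℝ :=
  Real.pi ^ (-(1 : ℝ)/2) * Real.Gamma (v + 1/2) * (2*x) ^ v *
    ∫ t in Set.Ioi (0:ℝ), Real.cos t * (t^2 + x^2) ^ (-(v + 1/2))

open scoped Topology

/-- The Laplace transform of a real function at a complex argument. -/
noncomputable def complexLaplace (f : ℝ → ℝ) (l : ℂ) : ℂ :=
  ∫ t in Ioi (0:ℝ), Complex.exp (-l * t) * (f t : ℂ)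

lemma norm_cexp_neg_mul (l : ℂ) (t : ℝ) : ‖Complex.exp (-l * t)‖ = Real.exp (-l.re * t) := by
  rw [Complex.norm_exp]; simp

lemma norm_cexp_neg_mul_mul (f : ℝ → ℝ) (l : ℂ) (t : ℝ) :
    ‖Complex.exp (-l * t) * (f t : ℂ)‖ = ‖Real.exp (-l.re * t) * f t‖ := by
  rw [norm_mul, norm_cexp_neg_mul, Complex.norm_real, norm_mul, Real.norm_of_nonneg (exp_pos _).le]

lemma aestronglyMeasurable_cexp_neg_mul_mul {f : ℝ → ℝ} {c : ℝ} (l : ℂ)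
    (hf : IntegrableOn (fun t => Real.exp (-c * t) * f t) (Ioi 0)) :
    AEStronglyMeasurable (fun t : ℝ => Complex.exp (-l * t) * (f t : ℂ))
      (volume.restrict (Ioi 0)) := by
  have h : (fun t : ℝ => Complex.exp (-l * t) * (f t : ℂ)) = fun t : ℝ =>
      Complex.exp (-l * t) * ((Real.exp (c * t) * (Real.exp (-c * t) * f t) : ℝ) : ℂ) := by
    ext t
    rw [← mul_assoc, ← Real.exp_add]
    simp
  rw [h]
  refine AEStronglyMeasurable.mul (by fun_prop) ?_
  refine Complex.continuous_ofReal.comp_aestronglyMeasurable ?_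
  exact AEStronglyMeasurable.mul (by fun_prop) hf.aestronglyMeasurable

lemma integrableOn_complexLaplace {f : ℝ → ℝ} {l : ℂ}
    (hf : IntegrableOn (fun t => Real.exp (-l.re * t) * f t) (Ioi 0)) :
    IntegrableOn (fun t : ℝ => Complex.exp (-l * t) * (f t : ℂ)) (Ioi 0) :=
  hf.congr' (aestronglyMeasurable_cexp_neg_mul_mul l hf)
    (.of_forall fun t => (norm_cexp_neg_mul_mul f l t).symm)

lemma complexLaplace_ofReal (f : ℝ → ℝ) (l : ℝ) :
    complexLaplace f (l : ℂ) = ((∫ t in Ioi (0:ℝ), Real.exp (-l * t) * f t : ℝ) : ℂ) := by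
  rw [complexLaplace, ← integral_complex_ofReal]
  congr 1; ext t; push_cast; rfl

lemma differentiableOn_complexLaplace {f : ℝ → ℝ}
    (hf : ∀ c > (0:ℝ), IntegrableOn (fun t => Real.exp (-c * t) * f t) (Ioi 0)) :
    DifferentiableOn ℂ (complexLaplace f) {l | 0 < l.re} := by
  intro l₀ hl₀
  simp only [mem_ofPred_eq] at hl₀
  set r := l₀.re / 2 with hr
  have hr0 : 0 < r := by positivity
  have hs : {l : ℂ | r < l.re} ∈ 𝓝 l₀ :=
    (isOpen_lt continuous_const Complex.continuous_re).mem_nhds (by simp [hr]; linarith)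
  have key := hasDerivAt_integral_of_dominated_loc_of_deriv_le (𝕜 := ℂ)
    (μ := volume.restrict (Ioi (0:ℝ))) (x₀ := l₀) (s := {l : ℂ | r < l.re})
    (F := fun l t => Complex.exp (-l * t) * (f t : ℂ))
    (F' := fun l t => (-(t:ℂ)) * (Complex.exp (-l * t) * (f t : ℂ)))
    (bound := fun t => (2 / r) * ‖Real.exp (-(r/2) * t) * f t‖) hs
    (.of_forall fun l => aestronglyMeasurable_cexp_neg_mul_mul l (hf r hr0))
    (integrableOn_complexLaplace (hf _ hl₀))
    (AEStronglyMeasurable.mul (by fun_prop)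
      (aestronglyMeasurable_cexp_neg_mul_mul l₀ (hf r hr0)))
    ?_ ((hf (r/2) (by positivity)).norm.const_mul _) ?_
  · exact key.2.differentiableAt.differentiableWithinAt
  · refine (ae_restrict_iff' measurableSet_Ioi).2 (.of_forall fun t ht l hl => ?_)
    simp only [mem_Ioi, mem_ofPred_eq] at ht hl
    rw [norm_mul, norm_cexp_neg_mul_mul, norm_mul, norm_mul, norm_neg, Complex.norm_real,
      Real.norm_of_nonneg ht.le, Real.norm_of_nonneg (exp_pos _).le,
      Real.norm_of_nonneg (exp_pos _).le, ← mul_assoc, ← mul_assoc]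
    refine mul_le_mul_of_nonneg_right ?_ (norm_nonneg _)
    have h1 : t ≤ (2/r) * Real.exp (r/2*t) := by
      have := Real.add_one_le_exp (r/2*t)
      rw [div_mul_eq_mul_div, le_div_iff₀ hr0]
      linarith
    calc t * Real.exp (-l.re * t) ≤ ((2/r) * Real.exp (r/2*t)) * Real.exp (-r * t) := by
          gcongr
      _ = _ := by rw [mul_assoc, ← Real.exp_add]; ring_nf
  · refine .of_forall fun t l _ => ?_
    have h1 : HasDerivAt (fun l : ℂ => -l * t) (-(t:ℂ)) l := by
      simpa using (hasDerivAt_id l).neg.mul_const (t:ℂ)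
    exact (h1.cexp.mul_const (f t : ℂ)).congr_deriv (by ring)

/-- The integrand whose Laplace transform represents `besselK`. -/
noncomputable def besselKernel (a w τ : ℝ) : ℝ := τ ^ a * Real.exp (-(w ^ 2 / (2 * τ)))

/-- The complex Laplace transform of `besselKernel`. -/
noncomputable def besselLaplace (a w : ℝ) (l : ℂ) : ℂ := complexLaplace (besselKernel a w) l

lemma exp_neg_le_factorial_div_pow {y : ℝ} (hy : 0 < y) (n : ℕ) :
    Real.exp (-y) ≤ n.factorial / y ^ n := by
  have := Real.pow_div_factorial_le_exp y hy.le n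
  rw [Real.exp_neg, inv_le_comm₀ (exp_pos _) (by positivity), inv_div]
  exact this

lemma besselKernel_pos (a w : ℝ) {τ : ℝ} (hτ : 0 < τ) : 0 < besselKernel a w τ := by
  unfold besselKernel; positivity

lemma besselKernel_anti (a : ℝ) {w w' τ : ℝ} (hw : 0 ≤ w) (h : w ≤ w') (hτ : 0 < τ) :
    besselKernel a w' τ ≤ besselKernel a w τ := by
  unfold besselKernel; gcongr

lemma besselKernel_le_rpow (a : ℝ) {w τ : ℝ} (hw : 0 < w) (n : ℕ) (hτ : 0 < τ) :
    besselKernel a w τ ≤ (n.factorial * (2 / w ^ 2) ^ n) * τ ^ (a + n) := by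
  have h := exp_neg_le_factorial_div_pow (y := w ^ 2 / (2 * τ)) (by positivity) n
  rw [besselKernel, rpow_add hτ, rpow_natCast]
  calc _ ≤ τ ^ a * (n.factorial / (w ^ 2 / (2 * τ)) ^ n) := by gcongr
    _ = _ := by rw [div_pow, div_pow, mul_pow]; field_simp

lemma integrableOn_exp_mul_besselKernel (a : ℝ) {w c : ℝ} (hw : 0 < w) (hc : 0 < c) :
    IntegrableOn (fun τ => Real.exp (-c * τ) * besselKernel a w τ) (Ioi 0) := by
  obtain ⟨n, hn⟩ := exists_nat_gt (-1 - a)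
  have h := (integrableOn_rpow_mul_exp_neg_mul_rpow (p := 1) (s := a + n) (b := c)
    (by linarith) one_pos hc).const_mul (n.factorial * (2 / w ^ 2) ^ n)
  refine Integrable.mono' h ?_ ?_
  · have : Measurable (besselKernel a w) := by unfold besselKernel; fun_prop
    fun_prop
  · refine (ae_restrict_iff' measurableSet_Ioi).2 (.of_forall fun t ht => ?_)
    rw [Real.norm_of_nonneg (mul_pos (exp_pos _) (besselKernel_pos a w ht)).le, rpow_one]
    calc _ ≤ Real.exp (-c * t) * ((n.factorial * (2 / w ^ 2) ^ n) * t ^ (a + n)) := by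
          gcongr; exact besselKernel_le_rpow a hw n ht
      _ = _ := by ring

lemma integrableOn_besselLaplace (a : ℝ) {w : ℝ} (hw : 0 < w) {l : ℂ} (hl : 0 < l.re) :
    IntegrableOn (fun τ : ℝ => Complex.exp (-l * τ) * (besselKernel a w τ : ℂ)) (Ioi 0) :=
  integrableOn_complexLaplace (integrableOn_exp_mul_besselKernel a hw hl)

lemma differentiableOn_besselLaplace (a : ℝ) {w : ℝ} (hw : 0 < w) :
    DifferentiableOn ℂ (besselLaplace a w) {l | 0 < l.re} :=
  differentiableOn_complexLaplace fun _ hc => integrableOn_exp_mul_besselKernel a hw hc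

lemma hasDerivAt_besselKernel_left (a w : ℝ) {τ : ℝ} (hτ : 0 < τ) :
    HasDerivAt (fun w => besselKernel a w τ) (-w * besselKernel (a - 1) w τ) w := by
  unfold besselKernel
  have h1 : HasDerivAt (fun w : ℝ => -(w ^ 2 / (2 * τ))) (-(2 * w / (2 * τ))) w := by
    simpa using ((hasDerivAt_pow 2 w).div_const (2 * τ)).fun_neg
  refine (h1.exp.const_mul (τ ^ a)).congr_deriv ?_
  rw [rpow_sub_one hτ.ne']
  field_simp

lemma hasDerivAt_besselLaplace (a : ℝ) {w : ℝ} (hw : 0 < w) {l : ℂ} (hl : 0 < l.re) :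
    HasDerivAt (fun w => besselLaplace a w l) (-w * besselLaplace (a - 1) w l) w := by
  have hs : Ioo (w / 2) (2 * w) ∈ 𝓝 w := Ioo_mem_nhds (by linarith) (by linarith)
  have key := hasDerivAt_integral_of_dominated_loc_of_deriv_le (𝕜 := ℝ)
    (μ := volume.restrict (Ioi (0:ℝ))) (x₀ := w) (s := Ioo (w / 2) (2 * w))
    (F := fun w t => Complex.exp (-l * t) * (besselKernel a w t : ℂ))
    (F' := fun w t => (-(w:ℂ)) * (Complex.exp (-l * t) * (besselKernel (a - 1) w t : ℂ)))
    (bound := fun t => (2 * w) * (Real.exp (-l.re * t) * besselKernel (a - 1) (w / 2) t)) hs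
    ?_ (integrableOn_besselLaplace a hw hl)
    ((integrableOn_besselLaplace (a - 1) hw hl).aestronglyMeasurable.const_mul _)
    ?_ ((integrableOn_exp_mul_besselKernel (a - 1) (by positivity) hl).const_mul _) ?_
  · refine key.2.congr_deriv ?_
    rw [besselLaplace, complexLaplace, integral_const_mul]
  · filter_upwards [hs] with x hx
    exact (integrableOn_besselLaplace a (by linarith [hx.1]) hl).aestronglyMeasurable
  · refine (ae_restrict_iff' measurableSet_Ioi).2 (.of_forall fun t ht x hx => ?_)
    have hx0 : 0 < x := by linarith [hx.1]
    rw [norm_mul, norm_cexp_neg_mul_mul, norm_neg, Complex.norm_real, Real.norm_of_nonneg hx0.le,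
      Real.norm_of_nonneg (mul_pos (exp_pos _) (besselKernel_pos _ _ ht)).le]
    have := besselKernel_anti (a - 1) (by positivity) hx.1.le ht
    have h2 := hx.2.le
    have := (besselKernel_pos (a - 1) x ht).le
    gcongr
  · refine (ae_restrict_iff' measurableSet_Ioi).2 (.of_forall fun t ht x hx => ?_)
    refine (((hasDerivAt_besselKernel_left a x ht).ofReal_comp).const_mul
      (Complex.exp (-l * t))).congr_deriv ?_
    push_cast; ring

lemma hasDerivAt_besselKernel_right (a w : ℝ) {τ : ℝ} (hτ : 0 < τ) :
    HasDerivAt (besselKernel a w)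
      (a * besselKernel (a - 1) w τ + w ^ 2 / 2 * besselKernel (a - 2) w τ) τ := by
  unfold besselKernel
  have h1 : HasDerivAt (fun τ : ℝ => -(w ^ 2 / (2 * τ))) (w ^ 2 / 2 / τ ^ 2) τ := by
    have := ((hasDerivAt_inv hτ.ne').const_mul (w ^ 2 / 2)).neg
    refine (this.congr_of_eventuallyEq ?_).congr_deriv ?_
    · refine .of_forall fun x => ?_
      simp only [Pi.neg_apply]; ring
    · ring
  refine ((Real.hasDerivAt_rpow_const (p := a) (Or.inl hτ.ne')).mul h1.exp).congr_deriv ?_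
  rw [show a - 2 = a - 1 - 1 by ring, rpow_sub_one hτ.ne' (a - 1), rpow_sub_one hτ.ne' a]
  field_simp

lemma tendsto_besselKernel_zero (a : ℝ) {w : ℝ} (hw : 0 < w) :
    Tendsto (besselKernel a w) (𝓝[>] 0) (𝓝 0) := by
  obtain ⟨n, hn⟩ := exists_nat_gt (-a)
  have hp : 0 < a + n := by linarith
  have h : Tendsto (fun τ : ℝ => (n.factorial * (2 / w ^ 2) ^ n) * τ ^ (a + n)) (𝓝[>] 0) (𝓝 0) := by
    have := (Real.continuousAt_rpow_const 0 (a + n) (Or.inr hp.le)).tendsto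
    rw [Real.zero_rpow hp.ne'] at this
    simpa using (this.mono_left nhdsWithin_le_nhds).const_mul (n.factorial * (2 / w ^ 2) ^ n)
  refine squeeze_zero' ?_ ?_ h
  · filter_upwards [self_mem_nhdsWithin] with t ht using (besselKernel_pos a w ht).le
  · filter_upwards [self_mem_nhdsWithin] with t ht using besselKernel_le_rpow a hw n ht

lemma mul_besselLaplace (a : ℝ) {w : ℝ} (hw : 0 < w) {l : ℂ} (hl : 0 < l.re) :
    l * besselLaplace a w l =
      a * besselLaplace (a - 1) w l + w ^ 2 / 2 * besselLaplace (a - 2) w l := by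
  have hi := fun b => integrableOn_besselLaplace b hw hl
  have hu : ∀ t ∈ Ioi (0:ℝ), HasDerivAt (fun t : ℝ => Complex.exp (-l * t))
      (-l * Complex.exp (-l * t)) t := fun t _ => by
    have h1 : HasDerivAt (fun t : ℝ => -l * (t:ℂ)) (-l) t := by
      simpa using (Complex.ofRealCLM.hasDerivAt (x := t)).const_mul (-l)
    exact h1.cexp.congr_deriv (by ring)
  have hv : ∀ t ∈ Ioi (0:ℝ), HasDerivAt (fun t : ℝ => (besselKernel a w t : ℂ))
      ((a * besselKernel (a - 1) w t + w ^ 2 / 2 * besselKernel (a - 2) w t : ℝ) : ℂ) t :=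
    fun t ht => (hasDerivAt_besselKernel_right a w ht).ofReal_comp
  have hint1 := (hi a).const_mul (-l)
  have hint2 := ((hi (a - 1)).const_mul (a : ℂ)).fun_add ((hi (a - 2)).const_mul (w ^ 2 / 2 : ℂ))
  have e1 : (fun t : ℝ => -l * Complex.exp (-l * t) * (besselKernel a w t : ℂ)) =
      fun t : ℝ => -l * (Complex.exp (-l * t) * (besselKernel a w t : ℂ)) := by
    ext t; ring
  have e2 : (fun t : ℝ => Complex.exp (-l * t) *
      ((a * besselKernel (a - 1) w t + w ^ 2 / 2 * besselKernel (a - 2) w t : ℝ) : ℂ)) =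
      fun t : ℝ => (a : ℂ) * (Complex.exp (-l * t) * (besselKernel (a - 1) w t : ℂ)) +
        (w ^ 2 / 2 : ℂ) * (Complex.exp (-l * t) * (besselKernel (a - 2) w t : ℂ)) := by
    ext t; push_cast; ring
  have hint : IntegrableOn ((fun t : ℝ => -l * Complex.exp (-l * t)) *
      (fun t : ℝ => (besselKernel a w t : ℂ)) + (fun t : ℝ => Complex.exp (-l * t)) *
      fun t : ℝ => ((a * besselKernel (a - 1) w t + w ^ 2 / 2 * besselKernel (a - 2) w t : ℝ) : ℂ))
      (Ioi 0) := by
    refine Integrable.add ?_ ?_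
    · exact hint1.congr (.of_forall fun t => (congrFun e1 t).symm)
    · exact hint2.congr (.of_forall fun t => (congrFun e2 t).symm)
  have h0 : Tendsto ((fun t : ℝ => Complex.exp (-l * t)) *
      fun t : ℝ => (besselKernel a w t : ℂ)) (𝓝[>] 0) (𝓝 0) := by
    have h1 : Tendsto (fun t : ℝ => Complex.exp (-l * t)) (𝓝[>] 0) (𝓝 1) := by
      have : Continuous fun t : ℝ => Complex.exp (-l * t) := by fun_prop
      simpa using (this.tendsto 0).mono_left (nhdsWithin_le_nhds (s := Ioi 0))
    have h2 := (Complex.continuous_ofReal.tendsto 0).comp (tendsto_besselKernel_zero a hw)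
    have h3 := h1.mul h2
    rw [Complex.ofReal_zero, mul_zero] at h3
    exact h3
  have hinf := tendsto_zero_of_hasDerivAt_of_integrableOn_Ioi
    (fun t ht => (hu t ht).mul (hv t ht)) hint (hi a)
  have key := integral_Ioi_deriv_mul_eq_sub hu hv hint h0 hinf
  have e3 : ∀ t : ℝ, -l * Complex.exp (-l * t) * (besselKernel a w t : ℂ) + Complex.exp (-l * t) *
      ((a * besselKernel (a - 1) w t + w ^ 2 / 2 * besselKernel (a - 2) w t : ℝ) : ℂ) = _ :=
    fun t => congrArg₂ (· + ·) (congrFun e1 t) (congrFun e2 t)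
  simp_rw [e3] at key
  rw [integral_add hint1 hint2, integral_add ((hi (a - 1)).const_mul (a : ℂ))
    ((hi (a - 2)).const_mul (w ^ 2 / 2 : ℂ))] at key
  simp only [integral_const_mul] at key
  simp only [besselLaplace, complexLaplace]
  linear_combination -key

lemma exists_norm_besselLaplace_le (a : ℝ) {l : ℂ} (hl : 0 < l.re) :
    ∃ C, ∀ w ≥ (1:ℝ), ‖besselLaplace a w l‖ ≤ C / w ^ 2 := by
  refine ⟨∫ τ in Ioi (0:ℝ), 4 * (Real.exp (-l.re * τ) * besselKernel (a + 1) (1 / 2) τ),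
    fun w hw => ?_⟩
  have hw0 : 0 < w := by linarith
  rw [← integral_div]
  refine norm_integral_le_of_norm_le
    (((integrableOn_exp_mul_besselKernel (a + 1) (by norm_num) hl).const_mul 4).div_const _) ?_
  refine (ae_restrict_iff' measurableSet_Ioi).2 (.of_forall fun t ht => ?_)
  have ht : 0 < t := ht
  rw [norm_cexp_neg_mul_mul, Real.norm_of_nonneg (mul_pos (exp_pos _) (besselKernel_pos _ _ ht)).le]
  have h : besselKernel a w t ≤ 4 * besselKernel (a + 1) (1 / 2) t / w ^ 2 := by
    have h1 := exp_neg_le_factorial_div_pow (y := w ^ 2 / (4 * t)) (by positivity) 1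
    have h2 : Real.exp (-(w ^ 2 / (4 * t))) ≤ Real.exp (-((1/2) ^ 2 / (2 * t))) := by
      rw [Real.exp_le_exp, neg_le_neg_iff, div_le_div_iff₀ (by positivity) (by positivity)]
      nlinarith [mul_pos ht ht, mul_le_mul_of_nonneg_right (one_le_pow₀ hw (n := 2)) ht.le]
    unfold besselKernel
    rw [show -(w ^ 2 / (2 * t)) = -(w ^ 2 / (4 * t)) + -(w ^ 2 / (4 * t)) by field_simp; ring,
      Real.exp_add, rpow_add_one ht.ne']
    calc _ ≤ t ^ a * (((1:ℕ).factorial / (w ^ 2 / (4 * t)) ^ 1) *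
          Real.exp (-((1/2) ^ 2 / (2 * t)))) := by gcongr
      _ = _ := by simp; field_simp
  calc _ ≤ Real.exp (-l.re * t) * (4 * besselKernel (a + 1) (1 / 2) t / w ^ 2) := by gcongr
    _ = _ := by ring

lemma besselLaplace_eq_scale (a : ℝ) {w : ℝ} (hw : 0 < w) (l : ℂ) :
    besselLaplace a w l = ((w ^ 2 * (w ^ 2) ^ a : ℝ) : ℂ) * besselLaplace a 1 (w ^ 2 * l) := by
  have hw2 : 0 < w ^ 2 := by positivity
  have h := integral_comp_mul_left_Ioi
    (fun t : ℝ => Complex.exp (-l * t) * (besselKernel a w t : ℂ)) 0 hw2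
  rw [mul_zero, eq_inv_smul_iff₀ hw2.ne'] at h
  rw [besselLaplace, complexLaplace, ← h, besselLaplace, complexLaplace, Complex.real_smul,
    Complex.ofReal_mul, mul_assoc]
  congr 1
  rw [← integral_const_mul]
  refine setIntegral_congr_fun measurableSet_Ioi fun t ht => ?_
  have ht : 0 < t := ht
  have h2 : besselKernel a w (w ^ 2 * t) = (w ^ 2) ^ a * besselKernel a 1 t := by
    unfold besselKernel
    rw [mul_rpow hw2.le ht.le, mul_assoc]
    congr 4
    field_simp
  simp only [h2]
  push_cast
  rw [show -l * ((w:ℂ) ^ 2 * t) = -(w ^ 2 * l) * t by ring]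
  ring

/-- `J` solves `J'' - (k / w) J' = 2 l J` on `(0, ∞)`, has derivative `J'`, and both vanish at
infinity. -/
structure DecayingBesselSolution (k : ℝ) (l : ℂ) (J J' : ℝ → ℂ) : Prop where
  hasDerivAt : ∀ w > 0, HasDerivAt J (J' w) w
  hasDerivAt' : ∀ w > 0, HasDerivAt J' (2 * l * J w + k / w * J' w) w
  tendsto : Tendsto J atTop (𝓝 0)
  tendsto' : Tendsto J' atTop (𝓝 0)

namespace DecayingBesselSolution

open ComplexConjugate

variable {k : ℝ} {l : ℂ} {J J' : ℝ → ℂ}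

lemma hasDerivAt_energy (h : DecayingBesselSolution k l J J') (z : ℂ) {w : ℝ} (hw : 0 < w) :
    HasDerivAt (fun w => w ^ (-k) * (z * (J' w * conj (J w))).re)
      (w ^ (-k) * (z.re * ‖J' w‖ ^ 2 + 2 * (z * l).re * ‖J w‖ ^ 2)) w := by
  have hc : HasDerivAt (fun w => conj (J w)) (conj (J' w)) w :=
    (Complex.conjCLE.toContinuousLinearMap.hasFDerivAt.comp_hasDerivAt w (h.hasDerivAt w hw))
  have h1 := ((h.hasDerivAt' w hw).mul hc).const_mul z
  have h2 : HasDerivAt (fun w => (z * (J' w * conj (J w))).re) _ w :=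
    Complex.reCLM.hasFDerivAt.comp_hasDerivAt w h1
  have h3 := (Real.hasDerivAt_rpow_const (p := -k) (Or.inl hw.ne')).mul h2
  refine h3.congr_deriv ?_
  rw [rpow_sub_one hw.ne']
  simp only [← Complex.normSq_eq_norm_sq, Complex.normSq_apply, Complex.reCLM_apply,
    show ((k:ℂ) / (w:ℂ)) = ((k / w : ℝ) : ℂ) by push_cast; rfl]
  simp
  ring

lemma tendsto_energy (h : DecayingBesselSolution k l J J') (hk : 0 ≤ k) (z : ℂ) :
    Tendsto (fun w => w ^ (-k) * (z * (J' w * conj (J w))).re) atTop (𝓝 0) := by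
  have h1 : Tendsto (fun w => ‖z * (J' w * conj (J w))‖) atTop (𝓝 0) := by
    have := ((h.tendsto'.norm.mul h.tendsto.norm).const_mul ‖z‖)
    simpa using this
  refine squeeze_zero_norm' ?_ h1
  filter_upwards [eventually_ge_atTop 1] with w hw
  rw [norm_mul, Real.norm_of_nonneg (rpow_nonneg (by linarith) _)]
  calc _ ≤ 1 * ‖z * (J' w * conj (J w))‖ := by
        gcongr
        · exact rpow_le_one_of_one_le_of_nonpos hw (by linarith)
        · exact Complex.abs_re_le_norm _
    _ = _ := one_mul _

lemma monotoneOn_energy (h : DecayingBesselSolution k l J J') {z : ℂ} (hz : 0 ≤ z.re)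
    (hzl : 0 ≤ (z * l).re) :
    MonotoneOn (fun w => w ^ (-k) * (z * (J' w * conj (J w))).re) (Ioi 0) := by
  refine monotoneOn_of_hasDerivWithinAt_nonneg (convex_Ioi 0)
    (fun x hx => (h.hasDerivAt_energy z hx).continuousAt.continuousWithinAt)
    (fun x hx => (h.hasDerivAt_energy z (interior_subset hx)).hasDerivWithinAt) fun x hx => ?_
  have : (0:ℝ) < x := interior_subset hx
  positivity

lemma energy_nonpos (h : DecayingBesselSolution k l J J') (hk : 0 ≤ k) {z : ℂ} (hz : 0 ≤ z.re)
    (hzl : 0 ≤ (z * l).re) {w : ℝ} (hw : 0 < w) :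
    w ^ (-k) * (z * (J' w * conj (J w))).re ≤ 0 := by
  refine ge_of_tendsto (h.tendsto_energy hk z) ?_
  filter_upwards [eventually_ge_atTop w] with x hx
  exact h.monotoneOn_energy hz hzl hw (hw.trans_le hx) hx

lemma antitoneOn_norm (h : DecayingBesselSolution k l J J') (hk : 0 ≤ k) (hl : 0 ≤ l.re) :
    AntitoneOn (fun w => ‖J w‖) (Ioi 0) := by
  have hd : ∀ w ∈ Ioi (0:ℝ), HasDerivAt (fun w => ‖J w‖ ^ 2) (2 * (J' w * conj (J w)).re) w := by
    intro w hw
    have := (h.hasDerivAt w hw).norm_sq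
    refine this.congr_deriv ?_
    rw [Complex.inner]
  have hanti : AntitoneOn (fun w => ‖J w‖ ^ 2) (Ioi 0) := by
    refine antitoneOn_of_hasDerivWithinAt_nonpos (convex_Ioi 0)
      (fun x hx => (hd x hx).continuousAt.continuousWithinAt)
      (fun x hx => (hd x (interior_subset hx)).hasDerivWithinAt) fun x hx => ?_
    have hx : (0:ℝ) < x := interior_subset hx
    have := h.energy_nonpos hk (z := 1) (by simp) (by simpa using hl) hx
    rw [one_mul] at this
    have := nonpos_of_mul_nonpos_right this (rpow_pos_of_pos hx _)
    linarith
  intro a ha b hb hab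
  exact (pow_le_pow_iff_left₀ (norm_nonneg _) (norm_nonneg _) two_ne_zero).1 (hanti ha hb hab)

lemma norm_deriv_le (h : DecayingBesselSolution k l J J') (hk : 0 ≤ k) (hl : 0 ≤ l.re)
    {a : ℝ} (ha : 1 ≤ a) : ‖J' a‖ ≤ (2 + 2 ^ (k + 1) * ‖l‖) * ‖J a‖ := by
  have ha0 : 0 < a := by linarith
  have hpos : ∀ x ∈ Icc a (a + 1), 0 < x := fun x hx => ha0.trans_le hx.1
  set N : ℝ → ℂ := fun w => ((w ^ (-k) : ℝ) : ℂ) * J' w with hN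
  have hNd : ∀ w > 0, HasDerivAt N (((w ^ (-k) : ℝ) : ℂ) * (2 * l * J w)) w := by
    intro w hw
    have h1 := (Real.hasDerivAt_rpow_const (p := -k) (Or.inl hw.ne')).ofReal_comp.mul
      (h.hasDerivAt' w hw)
    refine h1.congr_deriv ?_
    rw [rpow_sub_one hw.ne']
    push_cast
    ring
  set M := a ^ (-k) * (2 * ‖l‖ * ‖J a‖) with hM
  have hM0 : 0 ≤ M := by positivity
  have hNa : ∀ w ∈ Icc a (a + 1), ‖N w - N a‖ ≤ M := by
    intro w hw
    have := (convex_Icc a (a+1)).norm_image_sub_le_of_norm_hasDerivWithin_le (C := M)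
      (fun x hx => (hNd x (hpos x hx)).hasDerivWithinAt) (fun x hx => ?_)
      (left_mem_Icc.2 (by linarith)) hw
    · refine this.trans (mul_le_of_le_one_right hM0 ?_)
      rw [Real.norm_of_nonneg (by linarith [hw.1])]
      linarith [hw.2]
    · have hx0 := hpos x hx
      rw [norm_mul, Complex.norm_real, Real.norm_of_nonneg (rpow_nonneg hx0.le _), norm_mul,
        norm_mul, Complex.norm_two]
      have := h.antitoneOn_norm hk hl ha0 hx0 hx.1
      have h3 := rpow_le_rpow_of_nonpos ha0 hx.1 (neg_nonpos.2 hk)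
      simp only at this
      rw [hM]
      gcongr
  have hg : ∀ x > 0, HasDerivAt (fun x => J x - N a * ((x ^ (k + 1) / (k + 1) : ℝ) : ℂ))
      (((x ^ k : ℝ) : ℂ) * (N x - N a)) x := by
    intro x hx
    have h1 := ((Real.hasDerivAt_rpow_const (p := k + 1) (Or.inl hx.ne')).div_const
      (k + 1)).ofReal_comp.const_mul (N a)
    refine ((h.hasDerivAt x hx).sub h1).congr_deriv ?_
    have e1 : J' x = ((x ^ k : ℝ) : ℂ) * N x := by
      rw [hN]
      simp only
      rw [← mul_assoc, ← Complex.ofReal_mul, ← rpow_add hx]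
      simp
    have e2 : (k + 1) * x ^ (k + 1 - 1) / (k + 1) = x ^ k := by
      rw [add_sub_cancel_right]; field_simp
    rw [e2, e1]
    ring
  have hmv := (convex_Icc a (a+1)).norm_image_sub_le_of_norm_hasDerivWithin_le
    (C := (a + 1) ^ k * M) (fun x hx => (hg x (hpos x hx)).hasDerivWithinAt) (fun x hx => ?_)
    (left_mem_Icc.2 (by linarith)) (right_mem_Icc.2 (by linarith))
  swap
  · have hx0 := hpos x hx
    rw [norm_mul, Complex.norm_real, Real.norm_of_nonneg (rpow_nonneg hx0.le _)]
    have := hNa x hx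
    have := hx.2
    gcongr
  rw [add_sub_cancel_left, norm_one, mul_one] at hmv
  have hJ1 : ‖J (a + 1)‖ ≤ ‖J a‖ :=
    h.antitoneOn_norm hk hl ha0 (show (0:ℝ) < a + 1 by linarith) (by linarith)
  set q := ((a + 1) ^ (k + 1) - a ^ (k + 1)) / (k + 1) with hq
  have hqa : a ^ k ≤ q := by
    have := one_add_mul_self_le_rpow_one_add (s := 1 / a) (p := k + 1)
      (by linarith [one_div_pos.2 ha0]) (by linarith)
    rw [hq, le_div_iff₀ (by linarith)]
    have e : (a + 1) ^ (k + 1) = a ^ (k + 1) * (1 + 1 / a) ^ (k + 1) := by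
      rw [← mul_rpow ha0.le (by positivity)]; congr 1; field_simp
    rw [e]
    have h2 := mul_le_mul_of_nonneg_left this (rpow_nonneg ha0.le (k + 1))
    have e2 : a ^ (k + 1) = a ^ k * a := rpow_add_one ha0.ne' k
    have e3 : a ^ (k + 1) * (1 + (k + 1) * (1 / a)) = a ^ (k + 1) + a ^ k * (k + 1) := by
      rw [e2]; field_simp
    linarith
  have hNq : ‖N a‖ * q ≤ 2 * ‖J a‖ + (a + 1) ^ k * M := by
    have hq0 : 0 ≤ q := (rpow_nonneg ha0.le k).trans hqa
    have e : N a * (q : ℂ) = (J (a + 1) - J a) -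
        ((J (a + 1) - N a * (((a + 1) ^ (k + 1) / (k + 1) : ℝ) : ℂ)) -
          (J a - N a * ((a ^ (k + 1) / (k + 1) : ℝ) : ℂ))) := by
      rw [hq]; push_cast; ring
    calc ‖N a‖ * q = ‖N a * (q : ℂ)‖ := by
          rw [norm_mul (N a), Complex.norm_real q, Real.norm_of_nonneg hq0]
      _ ≤ _ := by
          rw [e]
          refine (norm_sub_le _ _).trans (add_le_add ?_ hmv)
          refine (norm_sub_le _ _).trans ?_
          linarith
  have hJN : ‖J' a‖ = ‖N a‖ * a ^ k := by
    rw [hN]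
    simp only
    rw [norm_mul, Complex.norm_real, Real.norm_of_nonneg (rpow_nonneg ha0.le _), rpow_neg ha0.le]
    field_simp
  have hr : (a + 1) ^ k * a ^ (-k) ≤ 2 ^ k := by
    rw [rpow_neg ha0.le, ← div_eq_mul_inv, ← div_rpow (by linarith) ha0.le]
    refine rpow_le_rpow (by positivity) ?_ hk
    rw [div_le_iff₀ ha0]; linarith
  calc ‖J' a‖ ≤ ‖N a‖ * q := by rw [hJN]; gcongr
    _ ≤ 2 * ‖J a‖ + ((a + 1) ^ k * a ^ (-k)) * (2 * ‖l‖ * ‖J a‖) := by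
        rw [hM, ← mul_assoc] at hNq; exact hNq
    _ ≤ 2 * ‖J a‖ + 2 ^ k * (2 * ‖l‖ * ‖J a‖) := by gcongr
    _ = _ := by rw [rpow_add_one two_ne_zero]; ring

lemma norm_sq_le (h : DecayingBesselSolution k l J J') (hk : 0 ≤ k) (hl : 0 ≤ l.re)
    {w : ℝ} (hw : 1 < w) :
    ‖l‖ * (w - 1) * w ^ (-k) * ‖J w‖ ^ 2 ≤
      2 * (2 + 2 ^ (k + 1) * ‖l‖) * Real.exp (-(√‖l‖ * (w - 1))) * ‖J 1‖ ^ 2 := by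
  have hw0 : 0 < w := by linarith
  obtain ⟨z, hzre, hzl, hznorm⟩ : ∃ z : ℂ, z.re = 1 ∧ ‖l‖ ≤ (z * l).re ∧ ‖z‖ = √2 := by
    rcases le_total 0 l.im with hi | hi
    · refine ⟨1 - Complex.I, by simp, ?_, ?_⟩
      · have := Complex.norm_le_abs_re_add_abs_im l
        rw [abs_of_nonneg hl, abs_of_nonneg hi] at this
        simpa using this
      · rw [Complex.norm_eq_sqrt_sq_add_sq]; simp; norm_num
    · refine ⟨1 + Complex.I, by simp, ?_, ?_⟩
      · have := Complex.norm_le_abs_re_add_abs_im l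
        rw [abs_of_nonneg hl, abs_of_nonpos hi] at this
        simpa [sub_eq_add_neg] using this
      · rw [Complex.norm_eq_sqrt_sq_add_sq]; simp; norm_num
  have hz0 : 0 ≤ z.re := by rw [hzre]; exact zero_le_one
  have hzl0 : 0 ≤ (z * l).re := (norm_nonneg _).trans hzl
  set D : ℝ → ℝ := fun w => w ^ (-k) * (z * (J' w * conj (J w))).re with hD
  set κ := 2 * √‖l‖ with hκ
  have hsq : √‖l‖ ^ 2 = ‖l‖ := Real.sq_sqrt (norm_nonneg _)
  have hDabs : ∀ x > 0, -D x ≤ x ^ (-k) * (√2 * (‖J' x‖ * ‖J x‖)) := by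
    intro x hx
    rw [hD]
    simp only
    rw [← mul_neg]
    gcongr
    refine (neg_le_abs _).trans ((Complex.abs_re_le_norm _).trans ?_)
    rw [norm_mul, norm_mul, hznorm, RCLike.norm_conj]
  have hmono : MonotoneOn (fun x => Real.exp (κ * x) * D x) (Ioi 0) := by
    have hd : ∀ x ∈ Ioi (0:ℝ), HasDerivAt (fun x => Real.exp (κ * x) * D x) _ x := fun x hx =>
      (((hasDerivAt_id x).const_mul κ).exp).mul (h.hasDerivAt_energy z hx)
    refine monotoneOn_of_hasDerivWithinAt_nonneg (convex_Ioi 0)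
      (fun x hx => (hd x hx).continuousAt.continuousWithinAt)
      (fun x hx => (hd x (interior_subset hx)).hasDerivWithinAt) fun x hx => ?_
    have hx : (0:ℝ) < x := interior_subset hx
    have h1 := mul_le_mul_of_nonneg_left (hDabs x hx) (show 0 ≤ κ by positivity)
    have h2 : κ * (√2 * (‖J' x‖ * ‖J x‖)) ≤ ‖J' x‖ ^ 2 + 2 * ‖l‖ * ‖J x‖ ^ 2 := by
      have := sq_nonneg (‖J' x‖ - √2 * √‖l‖ * ‖J x‖)
      have e : (‖J' x‖ - √2 * √‖l‖ * ‖J x‖) ^ 2 =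
        ‖J' x‖ ^ 2 + √2 ^ 2 * √‖l‖ ^ 2 * ‖J x‖ ^ 2 - κ * (√2 * (‖J' x‖ * ‖J x‖)) := by
        rw [hκ]; ring
      rw [e, hsq, Real.sq_sqrt zero_le_two] at this
      linarith
    have h3 : κ * (√2 * (‖J' x‖ * ‖J x‖)) ≤ z.re * ‖J' x‖ ^ 2 + 2 * (z * l).re * ‖J x‖ ^ 2 := by
      rw [hzre]
      nlinarith [sq_nonneg ‖J x‖]
    have h4 := mul_le_mul_of_nonneg_left h3 (rpow_nonneg hx.le (-k))
    simp only [id_eq, mul_one]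
    have e : Real.exp (κ * x) * κ * (x ^ (-k) * (z * (J' x * conj (J x))).re) +
        Real.exp (κ * x) * (x ^ (-k) * (z.re * ‖J' x‖ ^ 2 + 2 * (z * l).re * ‖J x‖ ^ 2)) =
        Real.exp (κ * x) * (κ * D x +
          x ^ (-k) * (z.re * ‖J' x‖ ^ 2 + 2 * (z * l).re * ‖J x‖ ^ 2)) := by
      rw [hD]; ring
    rw [e]
    refine mul_nonneg (exp_pos _).le ?_
    linarith
  set b := (w + 1) / 2 with hb
  have hb1 : 1 ≤ b := by rw [hb]; linarith
  have hb0 : 0 < b := by linarith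
  have hbw : b ≤ w := by rw [hb]; linarith
  set C := w ^ (-k) * (2 * ‖l‖ * ‖J w‖ ^ 2) with hC
  have hlow : C * (w - b) ≤ D w - D b := by
    have hm : MonotoneOn (fun x => D x - C * x) (Icc b w) := by
      have hd : ∀ x ∈ Icc b w, HasDerivAt (fun x => D x - C * x) _ x := fun x hx =>
        (h.hasDerivAt_energy z (hb0.trans_le hx.1)).sub ((hasDerivAt_id x).const_mul C)
      refine monotoneOn_of_hasDerivWithinAt_nonneg (convex_Icc _ _)
        (fun x hx => (hd x hx).continuousAt.continuousWithinAt)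
        (fun x hx => (hd x (interior_subset hx)).hasDerivWithinAt) fun x hx => ?_
      have hx : x ∈ Icc b w := interior_subset hx
      have hx0 : 0 < x := hb0.trans_le hx.1
      have h1 : ‖J w‖ ≤ ‖J x‖ := h.antitoneOn_norm hk hl hx0 hw0 hx.2
      have h2 := rpow_le_rpow_of_nonpos hx0 hx.2 (neg_nonpos.2 hk)
      rw [mul_one, sub_nonneg, hC, hzre]
      gcongr
      have : 2 * ‖l‖ * ‖J w‖ ^ 2 ≤ 2 * (z * l).re * ‖J x‖ ^ 2 := by gcongr
      nlinarith [sq_nonneg ‖J' x‖]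
    have := hm (left_mem_Icc.2 hbw) (right_mem_Icc.2 hbw) hbw
    simp only at this
    linarith
  have hDw : D w ≤ 0 := h.energy_nonpos hk hz0 hzl0 hw0
  have hDb : Real.exp (κ * 1) * D 1 ≤ Real.exp (κ * b) * D b :=
    hmono (show (0:ℝ) < 1 by norm_num) hb0 hb1
  have hDb' : -D b ≤ Real.exp (-(√‖l‖ * (w - 1))) * (-D 1) := by
    have := mul_le_mul_of_nonneg_left hDb (exp_pos (-(κ * b))).le
    rw [← mul_assoc _ _ (D 1), ← mul_assoc _ _ (D b), ← Real.exp_add, ← Real.exp_add, neg_add_cancel, Real.exp_zero,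
      one_mul, show -(κ * b) + κ * 1 = -(√‖l‖ * (w - 1)) by rw [hκ, hb]; ring] at this
    linarith
  have hD1 : -D 1 ≤ 2 * ((2 + 2 ^ (k + 1) * ‖l‖) * ‖J 1‖ ^ 2) := by
    refine (hDabs 1 one_pos).trans ?_
    have h2 : √2 ≤ 2 := by rw [Real.sqrt_le_left] <;> norm_num
    rw [one_rpow, one_mul]
    calc _ ≤ 2 * (((2 + 2 ^ (k + 1) * ‖l‖) * ‖J 1‖) * ‖J 1‖) := by
          gcongr; exact h.norm_deriv_le hk hl le_rfl
      _ = _ := by ring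
  calc ‖l‖ * (w - 1) * w ^ (-k) * ‖J w‖ ^ 2 = C * (w - b) := by rw [hC, hb]; ring
    _ ≤ -D b := by linarith
    _ ≤ Real.exp (-(√‖l‖ * (w - 1))) * (2 * ((2 + 2 ^ (k + 1) * ‖l‖) * ‖J 1‖ ^ 2)) :=
        hDb'.trans (by gcongr)
    _ = _ := by ring

lemma norm_le_div (h : DecayingBesselSolution k l J J') (hk : 0 ≤ k) (hl : 1 ≤ l.re)
    {w : ℝ} (hw : 1 < w) :
    ‖J w‖ ≤ √(2 * (2 + 2 ^ (k + 1)) * (Nat.factorial 8 / (w - 1) ^ 8) / ((w - 1) * w ^ (-k))) /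
      ‖l‖ ^ 2 * ‖J 1‖ := by
  have hw1 : 0 < w - 1 := by linarith
  have hw0 : 0 < w := by linarith
  have hl1 : 1 ≤ ‖l‖ := hl.trans (Complex.re_le_norm l)
  have hl0 : 0 < ‖l‖ := by linarith
  have h1 := h.norm_sq_le hk (by linarith) hw
  have h2 := exp_neg_le_factorial_div_pow (y := √‖l‖ * (w - 1)) (by positivity) 8
  rw [mul_pow, show √‖l‖ ^ 8 = (√‖l‖ ^ 2) ^ 4 by ring, Real.sq_sqrt hl0.le] at h2
  set A := Nat.factorial 8 / (w - 1) ^ 8 with hA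
  have hA0 : 0 ≤ A := by positivity
  have h3 : ‖l‖ * ((w - 1) * w ^ (-k) * ‖J w‖ ^ 2) ≤
      ‖l‖ * (2 * (2 + 2 ^ (k + 1)) * (A / ‖l‖ ^ 4) * ‖J 1‖ ^ 2) := by
    calc _ = ‖l‖ * (w - 1) * w ^ (-k) * ‖J w‖ ^ 2 := by ring
      _ ≤ _ := h1
      _ ≤ 2 * (2 * ‖l‖ + 2 ^ (k + 1) * ‖l‖) * (A / ‖l‖ ^ 4) * ‖J 1‖ ^ 2 := by
          gcongr
          · linarith
          · refine h2.trans (le_of_eq ?_)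
            rw [hA]; field_simp
      _ = _ := by ring
  have h4 := le_of_mul_le_mul_left h3 hl0
  have hp : 0 < (w - 1) * w ^ (-k) := mul_pos hw1 (rpow_pos_of_pos hw0 _)
  refine (pow_le_pow_iff_left₀ (norm_nonneg _) (by positivity) two_ne_zero).1 ?_
  rw [mul_pow, div_pow, Real.sq_sqrt (by positivity)]
  rw [← le_div_iff₀' hp] at h4
  refine h4.trans (le_of_eq ?_)
  field_simp

end DecayingBesselSolution

lemma decayingBesselSolution_besselLaplace (a : ℝ) {l : ℂ} (hl : 0 < l.re) :
    DecayingBesselSolution (2 * a + 1) l (fun w => besselLaplace a w l)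
      (fun w => -w * besselLaplace (a - 1) w l) where
  hasDerivAt w hw := hasDerivAt_besselLaplace a hw hl
  hasDerivAt' w hw := by
    have h1 : HasDerivAt (fun w : ℝ => -(w : ℂ)) (-1) w :=
      (Complex.ofRealCLM.hasDerivAt (x := w)).neg
    refine (h1.mul (hasDerivAt_besselLaplace (a - 1) hw hl)).congr_deriv ?_
    have h2 := mul_besselLaplace a hw hl
    have hw' : (w : ℂ) ≠ 0 := by exact_mod_cast hw.ne'
    rw [mul_assoc, h2, show a - 1 - 1 = a - 2 by ring]
    push_cast
    field_simp
    ring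
  tendsto := by
    obtain ⟨C, hC⟩ := exists_norm_besselLaplace_le a hl
    refine squeeze_zero_norm' (eventually_ge_atTop 1 |>.mono hC) ?_
    exact tendsto_const_nhds.div_atTop (tendsto_pow_atTop two_ne_zero)
  tendsto' := by
    obtain ⟨C, hC⟩ := exists_norm_besselLaplace_le (a - 1) hl
    have h : Tendsto (fun w : ℝ => C / w) atTop (𝓝 0) := tendsto_const_nhds.div_atTop tendsto_id
    refine squeeze_zero_norm' ?_ h
    filter_upwards [eventually_ge_atTop 1] with w hw
    have hw0 : 0 < w := by linarith
    rw [norm_mul, norm_neg, Complex.norm_real, Real.norm_of_nonneg hw0.le]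
    calc _ ≤ w * (C / w ^ 2) := by gcongr; exact hC w hw
      _ = _ := by field_simp

lemma integral_exp_mul_besselKernel_pos (a : ℝ) {w l : ℝ} (hw : 0 < w) (hl : 0 < l) :
    0 < ∫ τ in Ioi (0:ℝ), Real.exp (-l * τ) * besselKernel a w τ := by
  have hp : ∀ τ ∈ Ioi (0:ℝ), 0 < Real.exp (-l * τ) * besselKernel a w τ :=
    fun τ hτ => mul_pos (exp_pos _) (besselKernel_pos a w hτ)
  rw [setIntegral_pos_iff_support_of_nonneg_ae
    ((ae_restrict_iff' measurableSet_Ioi).2 (.of_forall fun τ hτ => (hp τ hτ).le))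
    (integrableOn_exp_mul_besselKernel a hw hl)]
  have hs : Function.support (fun τ => Real.exp (-l * τ) * besselKernel a w τ) ∩ Ioi 0 = Ioi 0 :=
    inter_eq_right.2 fun τ hτ => (hp τ hτ).ne'
  rw [hs, Real.volume_Ioi]
  exact ENNReal.zero_lt_top

lemma isOpen_re_pos : IsOpen {l : ℂ | 0 < l.re} :=
  isOpen_lt continuous_const Complex.continuous_re

lemma eqOn_re_pos_of_frequently {f g : ℂ → ℂ} (hf : DifferentiableOn ℂ f {l | 0 < l.re})
    (hg : DifferentiableOn ℂ g {l | 0 < l.re}) {l₀ : ℂ} (hl₀ : 0 < l₀.re) {r : ℝ} (hr : 0 < r)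
    (h : ∀ x > r, f (x * l₀) = g (x * l₀)) : EqOn f g {l | 0 < l.re} := by
  have hl0 : l₀ ≠ 0 := fun h => by simp [h] at hl₀
  refine (hf.analyticOnNhd isOpen_re_pos).eqOn_of_preconnected_of_frequently_eq
    (hg.analyticOnNhd isOpen_re_pos) (convex_halfSpace_re_gt 0).isPreconnected
    (z₀ := ((2 * r : ℝ) : ℂ) * l₀) ?_ ?_
  · simp only [mem_ofPred_eq, Complex.re_ofReal_mul]; positivity
  · have ht : Tendsto (fun x : ℝ => (x : ℂ) * l₀) (𝓝[>] (2 * r)) (𝓝[≠] (((2 * r : ℝ) : ℂ) * l₀)) := by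
      refine tendsto_nhdsWithin_iff.2 ⟨?_, ?_⟩
      · have : Continuous fun x : ℝ => (x : ℂ) * l₀ := by fun_prop
        exact (this.tendsto _).mono_left nhdsWithin_le_nhds
      · filter_upwards [self_mem_nhdsWithin] with x hx
        intro hx'
        have h1 := mul_right_cancel₀ hl0 hx'
        exact (ne_of_gt (mem_Ioi.1 hx)) (by exact_mod_cast h1)
    refine ht.frequently (Eventually.frequently ?_)
    filter_upwards [self_mem_nhdsWithin] with x hx
    exact h x (by have := mem_Ioi.1 hx; linarith)

lemma besselLaplace_one_ne_zero {a : ℝ} (ha : 0 ≤ 2 * a + 1) {l : ℂ} (hl : 0 < l.re) :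
    besselLaplace a 1 l ≠ 0 := by
  intro h0
  have hz : ∀ w > (1:ℝ), besselLaplace a 1 (w * l) = 0 := by
    intro w hw
    have hw0 : 0 < w := by linarith
    have h1 := (decayingBesselSolution_besselLaplace a hl).antitoneOn_norm ha hl.le
      (show (0:ℝ) < 1 by norm_num) (show 0 < √w by positivity) (Real.one_le_sqrt.2 hw.le)
    simp only [h0, norm_zero] at h1
    have h2 := norm_le_zero_iff.1 h1
    rw [besselLaplace_eq_scale a (by positivity), Real.sq_sqrt hw0.le] at h2
    rcases mul_eq_zero.1 h2 with h3 | h3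
    · have : 0 < w * w ^ a := by positivity
      exact absurd (by exact_mod_cast h3) this.ne'
    · rwa [← Complex.ofReal_pow, Real.sq_sqrt hw0.le] at h3
  have h3 := eqOn_re_pos_of_frequently (differentiableOn_besselLaplace a one_pos)
    (differentiableOn_const 0) hl one_pos hz (show (1:ℂ) ∈ {l : ℂ | 0 < l.re} by simp)
  have h4 := integral_exp_mul_besselKernel_pos a one_pos one_pos
  have h5 := complexLaplace_ofReal (besselKernel a 1) 1
  rw [← besselLaplace, Complex.ofReal_one, h3] at h5
  exact h4.ne' (Complex.ofReal_eq_zero.1 h5.symm)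

lemma integral_cos_mul_exp_neg_mul_sq {b : ℝ} (hb : 0 < b) :
    ∫ t in Ioi (0:ℝ), Real.cos t * Real.exp (-b * t ^ 2) =
      √(π / b) / 2 * Real.exp (-(1 / (4 * b))) := by
  have h1 := fourierIntegral_gaussian (b := b) (by simpa using hb) 1
  have h2 : ∀ x : ℝ, (Complex.exp (Complex.I * 1 * x) * Complex.exp (-b * x ^ 2)).re =
      Real.cos |x| * Real.exp (-b * |x| ^ 2) := by
    intro x
    rw [show (-(b:ℂ) * x ^ 2) = ((-b * x ^ 2 : ℝ) : ℂ) by push_cast; ring, ← Complex.ofReal_exp,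
      Complex.re_mul_ofReal, mul_one, mul_comm Complex.I, Complex.exp_ofReal_mul_I_re,
      Real.cos_abs, sq_abs]
  have hint : Integrable fun x : ℝ =>
      Complex.exp (Complex.I * 1 * x) * Complex.exp (-b * x ^ 2) := by
    refine (integrable_exp_neg_mul_sq hb).congr' (by fun_prop) (.of_forall fun x => ?_)
    rw [norm_mul, show (-(b:ℂ) * x ^ 2) = ((-b * x ^ 2 : ℝ) : ℂ) by push_cast; ring,
      ← Complex.ofReal_exp, Complex.norm_real, mul_one, mul_comm Complex.I,
      Complex.norm_exp_ofReal_mul_I, one_mul]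
  have h3 := integral_re hint
  rw [h1] at h3
  simp only [RCLike.re_to_complex, h2] at h3
  rw [integral_comp_abs (f := fun x => Real.cos x * Real.exp (-b * x ^ 2))] at h3
  have h4 : ((π : ℂ) / b) ^ (1 / 2 : ℂ) * Complex.exp (-1 ^ 2 / (4 * b)) =
      ((√(π / b) * Real.exp (-(1 / (4 * b))) : ℝ) : ℂ) := by
    rw [Real.sqrt_eq_rpow]
    push_cast
    rw [Complex.ofReal_cpow (by positivity)]
    push_cast
    congr 2
    ring
  rw [h4, Complex.ofReal_re] at h3
  linarith

lemma integrable_sq_add_sq_rpow {x p : ℝ} (hx : 0 < x) (hp : 1 / 2 < p) :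
    Integrable fun t : ℝ => (t ^ 2 + x ^ 2) ^ (-p) := by
  have h1 := integrable_rpow_neg_one_add_norm_sq (E := ℝ) (μ := volume) (r := 2 * p)
    (by simp; linarith)
  set m := min 1 (x ^ 2) with hm
  have hm0 : 0 < m := lt_min one_pos (by positivity)
  refine Integrable.mono' (h1.const_mul (m ^ (-p))) ?_ (.of_forall fun t => ?_)
  · have : Measurable fun t : ℝ => (t ^ 2 + x ^ 2) ^ (-p) := by fun_prop
    exact this.aestronglyMeasurable
  · have hpos : 0 < t ^ 2 + x ^ 2 := by positivity
    rw [Real.norm_of_nonneg (rpow_nonneg hpos.le _), show -(2 * p) / 2 = -p by ring,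
      ← mul_rpow hm0.le (by positivity)]
    refine rpow_le_rpow_of_nonpos (by positivity) ?_ (by linarith)
    rw [Real.norm_eq_abs, sq_abs]
    nlinarith [min_le_left 1 (x ^ 2), min_le_right 1 (x ^ 2), sq_nonneg t]

lemma integral_cos_mul_rpow_eq {v x : ℝ} (hv : 0 < v) (hx : 0 < x) :
    Real.Gamma (v + 1 / 2) * ∫ t in Ioi (0:ℝ), Real.cos t * (t ^ 2 + x ^ 2) ^ (-(v + 1 / 2)) =
      2 ^ (-v) * (√π / 2) *
        ∫ τ in Ioi (0:ℝ), Real.exp (-(x ^ 2 / 2) * τ) * besselKernel (v - 1) 1 τ := by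
  set p := v + 1 / 2 with hp
  have hp0 : 0 < p := by rw [hp]; linarith
  have hq : ∀ t : ℝ, 0 < (t ^ 2 + x ^ 2) / 2 := fun t => by positivity
  have hgam : ∀ t : ℝ, ∫ τ in Ioi (0:ℝ), τ ^ (p - 1) * Real.exp (-((t ^ 2 + x ^ 2) / 2 * τ)) =
      2 ^ p * ((t ^ 2 + x ^ 2) ^ (-p) * Real.Gamma p) := by
    intro t
    have h2 : (0:ℝ) < t ^ 2 + x ^ 2 := by positivity
    rw [Real.integral_rpow_mul_exp_neg_mul_Ioi hp0 (hq t), one_div, inv_div,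
      div_rpow two_pos.le h2.le, rpow_neg h2.le]
    ring
  have hgi : ∀ t : ℝ, IntegrableOn
      (fun τ : ℝ => τ ^ (p - 1) * Real.exp (-((t ^ 2 + x ^ 2) / 2 * τ))) (Ioi 0) := by
    intro t
    have := integrableOn_rpow_mul_exp_neg_mul_rpow (p := 1) (s := p - 1)
      (by linarith) one_pos (hq t)
    simpa only [rpow_one, neg_mul] using this
  set F : ℝ → ℝ → ℝ := fun t τ =>
    Real.cos t * (τ ^ (p - 1) * Real.exp (-((t ^ 2 + x ^ 2) / 2 * τ))) with hF
  have hmeas : Measurable (Function.uncurry F) := by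
    rw [hF]; unfold Function.uncurry; fun_prop
  have hint : Integrable (Function.uncurry F)
      ((volume.restrict (Ioi (0:ℝ))).prod (volume.restrict (Ioi (0:ℝ)))) := by
    rw [integrable_prod_iff hmeas.aestronglyMeasurable]
    refine ⟨.of_forall fun t => by exact (hgi t).const_mul (Real.cos t), ?_⟩
    have hn : ∀ t : ℝ, ∫ τ in Ioi (0:ℝ), ‖F t τ‖ =
        |Real.cos t| * (2 ^ p * ((t ^ 2 + x ^ 2) ^ (-p) * Real.Gamma p)) := by
      intro t
      rw [← hgam t, ← integral_const_mul]
      refine setIntegral_congr_fun measurableSet_Ioi fun τ hτ => ?_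
      have hτ : 0 < τ := hτ
      simp only [hF]
      rw [norm_mul, Real.norm_eq_abs, Real.norm_of_nonneg (by positivity)]
    simp only [Function.uncurry_apply_pair, hn]
    have hi := (((integrable_sq_add_sq_rpow hx (p := p) (by linarith)).mul_const
      (Real.Gamma p)).const_mul (2 ^ p)).restrict (s := Ioi (0:ℝ))
    refine hi.bdd_mul (c := 1) (by fun_prop) (.of_forall fun t => ?_)
    simpa using Real.abs_cos_le_one t
  have hswap := integral_integral_swap hint
  have hl : ∀ t : ℝ, ∫ τ in Ioi (0:ℝ), F t τ =
      2 ^ p * (Real.Gamma p * (Real.cos t * (t ^ 2 + x ^ 2) ^ (-p))) := by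
    intro t
    simp only [hF]
    rw [integral_const_mul, hgam]
    ring
  have hr : ∀ τ ∈ Ioi (0:ℝ), ∫ t in Ioi (0:ℝ), F t τ =
      (√2 * (√π / 2)) * (Real.exp (-(x ^ 2 / 2) * τ) * besselKernel (v - 1) 1 τ) := by
    intro τ hτ
    have hτ : 0 < τ := hτ
    have e : ∀ t : ℝ, F t τ = (τ ^ (p - 1) * Real.exp (-(x ^ 2 / 2) * τ)) *
        (Real.cos t * Real.exp (-(τ / 2) * t ^ 2)) := by
      intro t
      simp only [hF]
      rw [show -((t ^ 2 + x ^ 2) / 2 * τ) = -(x ^ 2 / 2) * τ + -(τ / 2) * t ^ 2 by ring,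
        Real.exp_add]
      ring
    simp only [e]
    rw [integral_const_mul, integral_cos_mul_exp_neg_mul_sq (by positivity), besselKernel,
      show π / (τ / 2) = 2 * π / τ by field_simp, Real.sqrt_div (by positivity),
      Real.sqrt_mul two_pos.le, show 4 * (τ / 2) = 2 * τ by ring,
      show p - 1 = (v - 1) + 1 / 2 by rw [hp]; ring, rpow_add hτ, ← Real.sqrt_eq_rpow, one_pow]
    field_simp
  simp only [hl] at hswap
  rw [setIntegral_congr_fun measurableSet_Ioi hr, integral_const_mul, integral_const_mul,
    integral_const_mul] at hswap
  have e : (2:ℝ) ^ p = 2 ^ v * √2 := by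
    rw [hp, rpow_add two_pos, Real.sqrt_eq_rpow]
  rw [e] at hswap
  have h2 : (0:ℝ) < 2 ^ v := by positivity
  rw [rpow_neg two_pos.le]
  have h3 : √2 ≠ 0 := by positivity
  field_simp
  field_simp at hswap
  linear_combination hswap

lemma besselK_eq {v x : ℝ} (hv : 0 < v) (hx : 0 < x) :
    besselK v x = x ^ v / 2 *
      ∫ τ in Ioi (0:ℝ), Real.exp (-(x ^ 2 / 2) * τ) * besselKernel (v - 1) 1 τ := by
  have h := integral_cos_mul_rpow_eq hv hx
  have h1 : π ^ (-(1:ℝ) / 2) * √π = 1 := by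
    rw [Real.sqrt_eq_rpow, ← rpow_add pi_pos]; norm_num
  have h2 : (2:ℝ) ^ v * 2 ^ (-v) = 1 := by rw [← rpow_add two_pos]; simp
  rw [besselK, mul_rpow two_pos.le hx.le]
  generalize (∫ τ in Ioi (0:ℝ), Real.exp (-(x ^ 2 / 2) * τ) * besselKernel (v - 1) 1 τ) = R at h ⊢
  generalize (∫ t in Ioi (0:ℝ), Real.cos t * (t ^ 2 + x ^ 2) ^ (-(v + 1 / 2))) = S at h ⊢
  linear_combination π ^ (-(1:ℝ) / 2) * 2 ^ v * x ^ v * h +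
    x ^ v / 2 * R * (2 ^ v * 2 ^ (-v)) * h1 + x ^ v / 2 * R * h2

lemma integral_exp_mul_besselKernel_eq_scale (a : ℝ) {w : ℝ} (hw : 0 < w) (l : ℝ) :
    ∫ τ in Ioi (0:ℝ), Real.exp (-l * τ) * besselKernel a w τ =
      w ^ 2 * (w ^ 2) ^ a * ∫ τ in Ioi (0:ℝ), Real.exp (-(w ^ 2 * l) * τ) * besselKernel a 1 τ := by
  have h := besselLaplace_eq_scale a hw l
  rw [show (w : ℂ) ^ 2 * (l : ℂ) = ((w ^ 2 * l : ℝ) : ℂ) by push_cast; ring, besselLaplace,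
    besselLaplace, complexLaplace_ofReal, complexLaplace_ofReal] at h
  exact_mod_cast h

lemma besselK_div_besselK {v w s : ℝ} (hv : 0 < v) (hw : 0 < w) (hs : 0 < s) :
    besselK v (w * s) / besselK v s =
      w ^ (-v) * ((∫ τ in Ioi (0:ℝ), Real.exp (-(s ^ 2 / 2) * τ) * besselKernel (v - 1) w τ) /
        ∫ τ in Ioi (0:ℝ), Real.exp (-(s ^ 2 / 2) * τ) * besselKernel (v - 1) 1 τ) := by
  rw [besselK_eq hv hs, besselK_eq hv (mul_pos hw hs),
    integral_exp_mul_besselKernel_eq_scale (v - 1) hw, mul_rpow hw.le hs.le,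
    show (w * s) ^ 2 / 2 = w ^ 2 * (s ^ 2 / 2) by ring]
  have h1 : w ^ 2 * (w ^ 2) ^ (v - 1) = w ^ v * w ^ v := by
    rw [← rpow_one_add' (by positivity) (by linarith), add_sub_cancel, ← mul_rpow hw.le hw.le, sq]
  have h2 : w ^ (-v) * w ^ v = 1 := by rw [← rpow_add hw]; simp
  have h3 : s ^ v ≠ 0 := by positivity
  have h4 := (integral_exp_mul_besselKernel_pos (v - 1) one_pos
    (show 0 < s ^ 2 / 2 by positivity)).ne'
  rw [h1]
  generalize (∫ τ in Ioi (0:ℝ), Real.exp (-(s ^ 2 / 2) * τ) * besselKernel (v - 1) 1 τ) = R at h4 ⊢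
  generalize (∫ τ in Ioi (0:ℝ), Real.exp (-(w ^ 2 * (s ^ 2 / 2)) * τ) *
    besselKernel (v - 1) 1 τ) = S
  have h5 : w ^ v * s ^ v / 2 * S / (s ^ v / 2 * R) = w ^ v * S / R := by field_simp
  rw [h5]
  linear_combination (-(w ^ v * S / R)) * h2

lemma integrableOn_Ioi_comp_add_right {f : ℝ → ℝ} {a c : ℝ} :
    IntegrableOn (fun t => f (t + c)) (Ioi a) ↔ IntegrableOn f (Ioi (a + c)) := by
  have h := (measurePreserving_add_right volume c).integrableOn_comp_preimage
    (f := f) (s := Ioi (a + c)) (measurableEmbedding_addRight c)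
  rwa [preimage_add_const_Ioi, add_sub_cancel_right] at h

lemma besselK_zero_left {x : ℝ} (hx : 0 < x) : besselK 0 x = 0 := by
  have hni : ¬ IntegrableOn (fun t : ℝ => Real.cos t * (t ^ 2 + x ^ 2) ^ (-(0 + 1 / 2 : ℝ)))
      (Ioi 0) := by
    intro h
    have hA : IntegrableOn (fun t : ℝ => Real.cos t ^ 2 * (t + x)⁻¹) (Ioi 0) := by
      refine Integrable.mono h ?_ ?_
      · exact (by fun_prop : Measurable fun t : ℝ => Real.cos t ^ 2 * (t + x)⁻¹).aestronglyMeasurable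
      · refine (ae_restrict_iff' measurableSet_Ioi).2 (.of_forall fun t ht => ?_)
        have ht : 0 < t := ht
        have h1 : (t + x)⁻¹ ≤ (t ^ 2 + x ^ 2) ^ (-(0 + 1 / 2 : ℝ)) := by
          rw [rpow_neg (by positivity), zero_add, ← Real.sqrt_eq_rpow]
          refine inv_anti₀ (by positivity) ?_
          rw [Real.sqrt_le_left (by positivity)]
          nlinarith [mul_pos ht hx]
        rw [norm_mul, norm_mul, norm_pow, Real.norm_of_nonneg (show 0 ≤ (t + x)⁻¹ by positivity),
          Real.norm_of_nonneg (rpow_nonneg (show 0 ≤ t ^ 2 + x ^ 2 by positivity) _)]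
        have h2 : ‖Real.cos t‖ ^ 2 ≤ ‖Real.cos t‖ :=
          pow_le_of_le_one (norm_nonneg _) (Real.abs_cos_le_one t) two_ne_zero
        gcongr
    have hB : IntegrableOn (fun t : ℝ => Real.sin t ^ 2 * (t + π / 2 + x)⁻¹) (Ioi 0) := by
      have h1 : IntegrableOn (fun t : ℝ => Real.cos t ^ 2 * (t + x)⁻¹) (Ioi (0 + π / 2)) :=
        hA.mono_set (Ioi_subset_Ioi (by positivity))
      have h2 := integrableOn_Ioi_comp_add_right.2 h1
      refine h2.congr (.of_forall fun t => ?_)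
      simp [Real.cos_add_pi_div_two]
    have hC := hA.add hB
    have hD : IntegrableOn (fun t : ℝ => (t + (π / 2 + x))⁻¹) (Ioi 0) := by
      refine Integrable.mono' hC ?_ ?_
      · exact (by fun_prop : Measurable fun t : ℝ => (t + (π / 2 + x))⁻¹).aestronglyMeasurable
      · refine (ae_restrict_iff' measurableSet_Ioi).2 (.of_forall fun t ht => ?_)
        have ht : 0 < t := ht
        have hpi := pi_pos
        rw [Real.norm_of_nonneg (by positivity)]
        have h1 : (t + (π / 2 + x))⁻¹ ≤ (t + x)⁻¹ := inv_anti₀ (by positivity) (by linarith)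
        have h2 := Real.sin_sq_add_cos_sq t
        have h3 := mul_le_mul_of_nonneg_left h1 (sq_nonneg (Real.cos t))
        simp only [Pi.add_apply]
        rw [add_assoc t (π / 2) x]
        linarith [congrArg (· * (t + (π / 2 + x))⁻¹) h2, add_mul (Real.sin t ^ 2) (Real.cos t ^ 2)
          (t + (π / 2 + x))⁻¹]
    have hE := (integrableOn_Ioi_comp_add_right (f := fun t => t⁻¹)).1 hD
    exact not_integrableOn_Ioi_inv hE
  rw [besselK, integral_undef hni, mul_zero]

/-- The parametrization `ξ ↦ 1 + 2πiξ` of the line `Re l = 1`. -/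
noncomputable def verticalLine (ξ : ℝ) : ℂ := 1 + (2 * π * ξ : ℝ) * Complex.I

lemma verticalLine_re (ξ : ℝ) : (verticalLine ξ).re = 1 := by simp [verticalLine]

lemma continuous_verticalLine : Continuous verticalLine := by unfold verticalLine; fun_prop

lemma sq_norm_verticalLine (ξ : ℝ) : ‖verticalLine ξ‖ ^ 2 = 1 + (2 * π * ξ) ^ 2 := by
  rw [← Complex.normSq_eq_norm_sq, Complex.normSq_apply]
  simp [verticalLine]
  ring

lemma norm_cexp_verticalLine_mul (ξ t : ℝ) :
    ‖Complex.exp (verticalLine ξ * t)‖ = Real.exp t := by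
  rw [Complex.norm_exp, Complex.re_mul_ofReal, verticalLine_re, one_mul]

lemma integrable_div_sq_norm_verticalLine (D : ℝ) :
    Integrable fun ξ => D / ‖verticalLine ξ‖ ^ 2 := by
  have h := (integrable_inv_one_add_sq.comp_mul_left' (R := 2 * π) (by positivity)).const_mul D
  simpa only [sq_norm_verticalLine, div_eq_mul_inv] using h

/-- The Bromwich integral of `F` along the line `Re l = 1`, without the factor `1 / (2πi)` and
with `l = 1 + 2πiξ` as a change of variables. -/
noncomputable def bromwichIntegral (F : ℂ → ℂ) (t : ℝ) : ℂ :=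
  ∫ ξ : ℝ, Complex.exp (verticalLine ξ * t) * F (verticalLine ξ)

lemma continuous_bromwich {F : ℂ → ℂ} (hF : ContinuousOn F {l | 0 < l.re}) (t : ℝ) :
    Continuous fun ξ : ℝ => Complex.exp (verticalLine ξ * t) * F (verticalLine ξ) := by
  refine Continuous.mul ?_ (hF.comp_continuous continuous_verticalLine fun ξ => ?_)
  · have := continuous_verticalLine
    fun_prop
  · simp [verticalLine_re]

lemma integrable_bromwich {F : ℂ → ℂ} (hF : ContinuousOn F {l | 0 < l.re}) {D : ℝ}
    (hD : ∀ l : ℂ, 1 ≤ l.re → ‖F l‖ ≤ D / ‖l‖ ^ 2) (t : ℝ) :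
    Integrable fun ξ : ℝ => Complex.exp (verticalLine ξ * t) * F (verticalLine ξ) := by
  refine ((integrable_div_sq_norm_verticalLine D).const_mul (Real.exp t)).mono'
    (continuous_bromwich hF t).aestronglyMeasurable (.of_forall fun ξ => ?_)
  rw [norm_mul, norm_cexp_verticalLine_mul]
  gcongr
  exact hD _ (verticalLine_re ξ).ge

lemma hasDerivAt_bromwichIntegral_param {F F' : ℝ → ℂ → ℂ} {w D : ℝ} {s : Set ℝ} (hs : s ∈ 𝓝 w)
    (hF : ∀ x ∈ s, ContinuousOn (F x) {l | 0 < l.re})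
    (hF' : ∀ x ∈ s, ContinuousOn (F' x) {l | 0 < l.re})
    (hD : ∀ x ∈ s, ∀ l : ℂ, 1 ≤ l.re → ‖F x l‖ ≤ D / ‖l‖ ^ 2)
    (hD' : ∀ x ∈ s, ∀ l : ℂ, 1 ≤ l.re → ‖F' x l‖ ≤ D / ‖l‖ ^ 2)
    (hd : ∀ x ∈ s, ∀ l : ℂ, 0 < l.re → HasDerivAt (fun x => F x l) (F' x l) x) (t : ℝ) :
    HasDerivAt (fun x => bromwichIntegral (F x) t) (bromwichIntegral (F' w) t) w := by
  have hw := mem_of_mem_nhds hs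
  refine (hasDerivAt_integral_of_dominated_loc_of_deriv_le
    (F' := fun x ξ => Complex.exp (verticalLine ξ * t) * F' x (verticalLine ξ))
    (bound := fun ξ => Real.exp t * (D / ‖verticalLine ξ‖ ^ 2)) hs
    (eventually_of_mem hs fun x hx => (continuous_bromwich (hF x hx) t).aestronglyMeasurable)
    (integrable_bromwich (hF w hw) (hD w hw) t)
    (continuous_bromwich (hF' w hw) t).aestronglyMeasurable
    (.of_forall fun ξ x hx => ?_)
    ((integrable_div_sq_norm_verticalLine D).const_mul _)
    (.of_forall fun ξ x hx => ?_)).2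
  · rw [norm_mul, norm_cexp_verticalLine_mul]
    gcongr
    exact hD' x hx _ (verticalLine_re ξ).ge
  · exact (hd x hx _ (by rw [verticalLine_re]; exact one_pos)).const_mul _

lemma hasDerivAt_bromwichIntegral {F : ℂ → ℂ} {D : ℝ} (hF : ContinuousOn F {l | 0 < l.re})
    (hD : ∀ l : ℂ, 1 ≤ l.re → ‖F l‖ ≤ D / ‖l‖ ^ 2)
    (hD' : ∀ l : ℂ, 1 ≤ l.re → ‖l * F l‖ ≤ D / ‖l‖ ^ 2) (t : ℝ) :
    HasDerivAt (bromwichIntegral F) (bromwichIntegral (fun l => l * F l) t) t := by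
  have hc : ContinuousOn (fun l => l * F l) {l | 0 < l.re} := continuousOn_id.mul hF
  refine (hasDerivAt_integral_of_dominated_loc_of_deriv_le
    (F' := fun x ξ => Complex.exp (verticalLine ξ * x) * (verticalLine ξ * F (verticalLine ξ)))
    (bound := fun ξ => Real.exp (t + 1) * (D / ‖verticalLine ξ‖ ^ 2))
    (Iio_mem_nhds (lt_add_one t))
    (.of_forall fun x => (continuous_bromwich hF x).aestronglyMeasurable)
    (integrable_bromwich hF hD t)
    (continuous_bromwich hc t).aestronglyMeasurable
    (.of_forall fun ξ x hx => ?_)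
    ((integrable_div_sq_norm_verticalLine D).const_mul _)
    (.of_forall fun ξ x hx => ?_)).2
  · rw [norm_mul, norm_cexp_verticalLine_mul]
    gcongr
    · exact (mem_Iio.1 hx).le
    · exact hD' _ (verticalLine_re ξ).ge
  · have h1 : HasDerivAt (fun x : ℝ => verticalLine ξ * x) (verticalLine ξ) x := by
      simpa using (Complex.ofRealCLM.hasDerivAt (x := x)).const_mul (verticalLine ξ)
    refine (h1.cexp.mul_const _).congr_deriv ?_
    ring

lemma ofReal_eq_bromwichIntegral {f : ℝ → ℝ} (hf : ContinuousOn f (Ici 0)) (hf0 : f 0 = 0)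
    (hint : IntegrableOn (fun t => Real.exp (-1 * t) * f t) (Ioi 0)) {D : ℝ}
    (hD : ∀ l : ℂ, 1 ≤ l.re → ‖complexLaplace f l‖ ≤ D / ‖l‖ ^ 2)
    (hc : ContinuousOn (complexLaplace f) {l | 0 < l.re}) {t : ℝ} (ht : 0 ≤ t) :
    (f t : ℂ) = bromwichIntegral (complexLaplace f) t := by
  set h : ℝ → ℂ := (Ici (0:ℝ)).indicator fun t => ((Real.exp (-1 * t) * f t : ℝ) : ℂ) with hh
  have hcont : Continuous h := by
    refine continuous_indicator (fun a ha => ?_) ?_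
    · rw [frontier_Ici, mem_singleton_iff] at ha
      simp [ha, hf0]
    · rw [isClosed_Ici.closure_eq]
      exact Complex.continuous_ofReal.comp_continuousOn
        ((by fun_prop : Continuous fun t : ℝ => Real.exp (-1 * t)).continuousOn.mul hf)
  have hhi : Integrable h := by
    rw [hh, integrable_indicator_iff measurableSet_Ici, integrableOn_Ici_iff_integrableOn_Ioi]
    exact hint.ofReal
  have hfour : ∀ ξ : ℝ, FourierTransform.fourier h ξ = complexLaplace f (verticalLine ξ) := by
    intro ξ
    rw [Real.fourier_eq', complexLaplace, ← integral_Ici_eq_integral_Ioi,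
      ← integral_indicator measurableSet_Ici]
    congr 1
    ext x
    by_cases hx : x ∈ Ici (0:ℝ)
    · simp only [hh, indicator_of_mem hx, smul_eq_mul]
      push_cast
      rw [← mul_assoc, ← Complex.exp_add]
      congr 2
      simp [verticalLine]
      ring
    · simp only [hh, indicator_of_notMem hx, smul_zero]
  have hFi : Integrable (FourierTransform.fourier h) := by
    have := integrable_bromwich hc hD 0
    simpa [funext hfour] using this
  have key := hhi.fourierInv_fourier_eq hFi (hcont.continuousAt (x := t))
  rw [Real.fourierInv_eq', show h t = _ from indicator_of_mem (mem_Ici.2 ht) _] at key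
  simp only [hfour] at key
  rw [bromwichIntegral]
  have e : (f t : ℂ) = Complex.exp t * ((Real.exp (-1 * t) * f t : ℝ) : ℂ) := by
    push_cast
    rw [← mul_assoc, ← Complex.exp_add]
    simp
  rw [e, ← key, ← integral_const_mul]
  congr 1
  ext ξ
  rw [smul_eq_mul, ← mul_assoc, ← Complex.exp_add]
  congr 2
  simp [verticalLine]
  ring

/-- The ratio of `besselLaplace` at `w` and at `1`, divided by the Laplace variable. -/
noncomputable def besselRatio (a w : ℝ) (l : ℂ) : ℂ :=
  besselLaplace a w l / (l * besselLaplace a 1 l)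

/-- The derivative of `besselRatio a w l` with respect to `w`. -/
noncomputable def besselRatioDeriv (a w : ℝ) (l : ℂ) : ℂ :=
  -w * besselLaplace (a - 1) w l / (l * besselLaplace a 1 l)

lemma mul_besselLaplace_one_ne_zero {a : ℝ} (ha : 0 ≤ 2 * a + 1) {l : ℂ} (hl : 0 < l.re) :
    l * besselLaplace a 1 l ≠ 0 :=
  mul_ne_zero (fun h => by simp [h] at hl) (besselLaplace_one_ne_zero ha hl)

lemma continuousOn_besselRatio {a w : ℝ} (ha : 0 ≤ 2 * a + 1) (hw : 0 < w) :
    ContinuousOn (besselRatio a w) {l | 0 < l.re} :=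
  (differentiableOn_besselLaplace a hw).continuousOn.div
    (continuousOn_id.mul (differentiableOn_besselLaplace a one_pos).continuousOn)
    fun _ hl => mul_besselLaplace_one_ne_zero ha hl

lemma continuousOn_besselRatioDeriv {a w : ℝ} (ha : 0 ≤ 2 * a + 1) (hw : 0 < w) :
    ContinuousOn (besselRatioDeriv a w) {l | 0 < l.re} :=
  (continuousOn_const.mul (differentiableOn_besselLaplace (a - 1) hw).continuousOn).div
    (continuousOn_id.mul (differentiableOn_besselLaplace a one_pos).continuousOn)
    fun _ hl => mul_besselLaplace_one_ne_zero ha hl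

lemma hasDerivAt_besselRatio (a : ℝ) {w : ℝ} (hw : 0 < w) {l : ℂ} (hl : 0 < l.re) :
    HasDerivAt (fun w => besselRatio a w l) (besselRatioDeriv a w l) w :=
  ((decayingBesselSolution_besselLaplace a hl).hasDerivAt w hw).div_const _

lemma hasDerivAt_besselRatioDeriv (a : ℝ) {w : ℝ} (hw : 0 < w) {l : ℂ} (hl : 0 < l.re) :
    HasDerivAt (fun w => besselRatioDeriv a w l)
      (2 * (l * besselRatio a w l) + (2 * a + 1 : ℝ) / w * besselRatioDeriv a w l) w := by
  refine (((decayingBesselSolution_besselLaplace a hl).hasDerivAt' w hw).div_const _).congr_deriv ?_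
  rw [besselRatio, besselRatioDeriv]
  ring

lemma exists_norm_besselRatio_le {a : ℝ} (ha : 0 ≤ 2 * a + 1) {w₁ : ℝ} (hw₁ : 1 < w₁) :
    ∃ D : ℝ, 0 ≤ D ∧ ∀ w > w₁, ∀ l : ℂ, 1 ≤ l.re → ‖besselRatio a w l‖ ≤ D / ‖l‖ ^ 2 ∧
      ‖l * besselRatio a w l‖ ≤ D / ‖l‖ ^ 2 ∧ ‖besselRatioDeriv a w l‖ ≤ D / ‖l‖ ^ 2 := by
  set C := √(2 * (2 + 2 ^ ((2 * a + 1) + 1)) * (Nat.factorial 8 / (w₁ - 1) ^ 8) /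
    ((w₁ - 1) * w₁ ^ (-(2 * a + 1)))) with hC
  set M : ℝ := 2 + 2 ^ ((2 * a + 1) + 1) with hM
  have hM1 : 1 ≤ M := by
    have : (0:ℝ) < 2 ^ ((2 * a + 1) + 1) := by positivity
    linarith
  have hC0 : 0 ≤ C := Real.sqrt_nonneg _
  refine ⟨M * C, by positivity, fun w hw l hl => ?_⟩
  have hl0 : 0 < l.re := by linarith
  have hl1 : 1 ≤ ‖l‖ := hl.trans (Complex.re_le_norm l)
  have hsol := decayingBesselSolution_besselLaplace a hl0
  have hw0 : 0 < w := by linarith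
  have h1 : 0 < ‖besselLaplace a 1 l‖ := norm_pos_iff.2 (besselLaplace_one_ne_zero ha hl0)
  have hJ : ‖besselLaplace a w l‖ ≤ C / ‖l‖ ^ 2 * ‖besselLaplace a 1 l‖ :=
    (hsol.antitoneOn_norm ha hl0.le (by simpa using by linarith) (mem_Ioi.2 hw0) hw.le).trans
      (hsol.norm_le_div ha hl hw₁)
  have hJ' : ‖-(w : ℂ) * besselLaplace (a - 1) w l‖ ≤ M * ‖l‖ * ‖besselLaplace a w l‖ := by
    refine (hsol.norm_deriv_le ha hl0.le (by linarith)).trans ?_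
    gcongr
    rw [hM]
    linarith
  have hb : ‖l * besselRatio a w l‖ ≤ C / ‖l‖ ^ 2 := by
    rw [besselRatio, norm_mul, norm_div, norm_mul, ← mul_div_assoc,
      mul_div_mul_left _ _ (by positivity), div_le_iff₀ h1]
    exact hJ
  have hCM : C / ‖l‖ ^ 2 ≤ M * C / ‖l‖ ^ 2 := by
    gcongr
    exact le_mul_of_one_le_left hC0 hM1
  refine ⟨?_, hb.trans hCM, ?_⟩
  · refine le_trans ?_ (hb.trans hCM)
    rw [norm_mul]
    exact le_mul_of_one_le_left (norm_nonneg _) hl1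
  · rw [besselRatioDeriv, norm_div, norm_mul l, div_le_iff₀ (by positivity)]
    calc _ ≤ M * ‖l‖ * (C / ‖l‖ ^ 2 * ‖besselLaplace a 1 l‖) := hJ'.trans (by gcongr)
      _ = _ := by ring

lemma hasDerivAt_bromwichIntegral_besselRatio {a : ℝ} (ha : 0 ≤ 2 * a + 1) {w : ℝ} (hw : 1 < w)
    (t : ℝ) : HasDerivAt (fun w => bromwichIntegral (besselRatio a w) t)
      (bromwichIntegral (besselRatioDeriv a w) t) w := by
  obtain ⟨D, -, hD⟩ := exists_norm_besselRatio_le ha (show 1 < (1 + w) / 2 by linarith)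
  have hpos : ∀ x ∈ Ioi ((1 + w) / 2), 0 < x := fun x hx => by
    have := mem_Ioi.1 hx
    linarith
  exact hasDerivAt_bromwichIntegral_param (Ioi_mem_nhds (show (1 + w) / 2 < w by linarith))
    (fun x hx => continuousOn_besselRatio ha (hpos x hx))
    (fun x hx => continuousOn_besselRatioDeriv ha (hpos x hx))
    (fun x hx l hl => (hD x hx l hl).1) (fun x hx l hl => (hD x hx l hl).2.2)
    (fun x hx l hl => hasDerivAt_besselRatio a (hpos x hx) hl) t

lemma hasDerivAt_bromwichIntegral_besselRatioDeriv {a : ℝ} (ha : 0 ≤ 2 * a + 1) {w : ℝ}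
    (hw : 1 < w) (t : ℝ) : HasDerivAt (fun w => bromwichIntegral (besselRatioDeriv a w) t)
      (2 * bromwichIntegral (fun l => l * besselRatio a w l) t +
        (2 * a + 1 : ℝ) / w * bromwichIntegral (besselRatioDeriv a w) t) w := by
  obtain ⟨D, hD0, hD⟩ := exists_norm_besselRatio_le ha (show 1 < (1 + w) / 2 by linarith)
  have hpos : ∀ x ∈ Ioi ((1 + w) / 2), 0 < x := fun x hx => by
    have := mem_Ioi.1 hx
    linarith
  have hw0 : 0 < w := by linarith
  have hw' : (1 + w) / 2 < w := by linarith
  have hDk : D ≤ (2 + (2 * a + 1)) * D := by nlinarith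
  have hc : ∀ x ∈ Ioi ((1 + w) / 2), ContinuousOn (fun l => l * besselRatio a x l)
      {l | 0 < l.re} := fun x hx => continuousOn_id.mul (continuousOn_besselRatio ha (hpos x hx))
  refine (hasDerivAt_bromwichIntegral_param (D := (2 + (2 * a + 1)) * D)
    (F := besselRatioDeriv a) (F' := fun w l =>
      2 * (l * besselRatio a w l) + (2 * a + 1 : ℝ) / w * besselRatioDeriv a w l)
    (Ioi_mem_nhds hw')
    (fun x hx => continuousOn_besselRatioDeriv ha (hpos x hx))
    (fun x hx => (continuousOn_const.mul (hc x hx)).add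
      (continuousOn_const.mul (continuousOn_besselRatioDeriv ha (hpos x hx))))
    (fun x hx l hl => (hD x hx l hl).2.2.trans (by gcongr))
    (fun x hx l hl => ?_)
    (fun x hx l hl => hasDerivAt_besselRatioDeriv a (hpos x hx) hl) t).congr_deriv ?_
  · obtain ⟨-, h2, h3⟩ := hD x hx l hl
    have hx1 : 1 ≤ x := by have := mem_Ioi.1 hx; linarith
    have hk : ‖((2 * a + 1 : ℝ) : ℂ) / x‖ ≤ 2 * a + 1 := by
      rw [norm_div, Complex.norm_real, Complex.norm_real, Real.norm_of_nonneg ha,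
        Real.norm_of_nonneg (hpos x hx).le]
      exact div_le_self ha hx1
    calc _ ≤ ‖2 * (l * besselRatio a x l)‖ + ‖((2 * a + 1 : ℝ) : ℂ) / x * besselRatioDeriv a x l‖ :=
          norm_add_le _ _
      _ ≤ 2 * (D / ‖l‖ ^ 2) + (2 * a + 1) * (D / ‖l‖ ^ 2) := by
          rw [norm_mul 2, norm_mul (_ / _), Complex.norm_two]
          gcongr
      _ = _ := by ring
  · rw [bromwichIntegral, bromwichIntegral, bromwichIntegral, ← integral_const_mul,
      ← integral_const_mul, ← integral_add]
    · congr 1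
      ext ξ
      ring
    · exact (integrable_bromwich (hc w hw') (fun l hl => (hD w hw' l hl).2.1) t).const_mul _
    · exact (integrable_bromwich (continuousOn_besselRatioDeriv ha hw0)
        (fun l hl => (hD w hw' l hl).2.2) t).const_mul _

lemma hasDerivAt_bromwichIntegral_besselRatio_time {a : ℝ} (ha : 0 ≤ 2 * a + 1) {w : ℝ}
    (hw : 1 < w) (t : ℝ) : HasDerivAt (bromwichIntegral (besselRatio a w))
      (bromwichIntegral (fun l => l * besselRatio a w l) t) t := by
  obtain ⟨D, -, hD⟩ := exists_norm_besselRatio_le ha (show 1 < (1 + w) / 2 by linarith)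
  have hw' : (1 + w) / 2 < w := by linarith
  exact hasDerivAt_bromwichIntegral (continuousOn_besselRatio ha (by linarith))
    (fun l hl => (hD w hw' l hl).1) (fun l hl => (hD w hw' l hl).2.1) t

lemma bromwichIntegral_const_mul (c : ℂ) (F : ℂ → ℂ) (t : ℝ) :
    bromwichIntegral (fun l => c * F l) t = c * bromwichIntegral F t := by
  rw [bromwichIntegral, bromwichIntegral, ← integral_const_mul]
  congr 1
  ext ξ
  ring

lemma besselK_mul_sqrt_div {v w l : ℝ} (hv : 0 < v) (hw : 0 < w) (hl : 0 < l) :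
    ((w ^ (1 + v) * besselK v (w * √(2 * l)) / (l * besselK v √(2 * l)) : ℝ) : ℂ) =
      w * besselRatio (v - 1) w l := by
  have hs : √(2 * l) ^ 2 / 2 = l := by rw [Real.sq_sqrt (by positivity)]; ring
  have h := besselK_div_besselK hv hw (show 0 < √(2 * l) by positivity)
  rw [hs] at h
  have h1 : w ^ (1 + v) * w ^ (-v) = w := by rw [← rpow_add hw]; simp
  rw [mul_comm l, ← div_div, mul_div_assoc (w ^ (1 + v)), h, besselRatio, besselLaplace, besselLaplace, complexLaplace_ofReal,
    complexLaplace_ofReal]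
  norm_cast
  generalize (∫ τ in Ioi (0:ℝ), Real.exp (-l * τ) * besselKernel (v - 1) w τ) = R
  generalize (∫ τ in Ioi (0:ℝ), Real.exp (-l * τ) * besselKernel (v - 1) 1 τ) = S
  rw [div_mul_eq_div_div]
  linear_combination (R / S / l) * h1

lemma ofReal_eq_mul_bromwichIntegral {v w : ℝ} (hv : 1 / 2 ≤ v) (hw : 1 < w) {f : ℝ → ℝ}
    (hf : ContinuousOn f (Ici 0)) (hf0 : f 0 = 0)
    (hK0 : ∀ l > (0:ℝ), besselK v √(2 * l) ≠ 0)
    (hK : ∀ l > (0:ℝ), ∫ t in Ioi (0:ℝ), Real.exp (-l * t) * f t =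
      w ^ (1 + v) * besselK v (w * √(2 * l)) / (l * besselK v √(2 * l)))
    {t : ℝ} (ht : 0 ≤ t) :
    (f t : ℂ) = w * bromwichIntegral (besselRatio (v - 1) w) t := by
  have hw0 : 0 < w := by linarith
  have ha : 0 ≤ 2 * (v - 1) + 1 := by linarith
  have hint : ∀ l > (0:ℝ), IntegrableOn (fun t => Real.exp (-l * t) * f t) (Ioi 0) := by
    intro l hl
    by_contra hni
    have h := hK l hl
    rw [integral_undef hni] at h
    have h1 : w * √(2 * l) = √(2 * (w ^ 2 * l)) := by
      rw [show 2 * (w ^ 2 * l) = w ^ 2 * (2 * l) by ring, Real.sqrt_mul (sq_nonneg w),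
        Real.sqrt_sq hw0.le]
    have h2 := hK0 (w ^ 2 * l) (by positivity)
    have h3 := hK0 l hl
    rw [h1] at h
    have h4 : w ^ (1 + v) ≠ 0 := by positivity
    exact div_ne_zero (mul_ne_zero h4 h2) (mul_ne_zero (ne_of_gt hl) h3) h.symm
  have hdiff := differentiableOn_complexLaplace hint
  have hdr : DifferentiableOn ℂ (fun l => w * besselRatio (v - 1) w l) {l | 0 < l.re} :=
    ((differentiableOn_besselLaplace (v - 1) hw0).div
      (differentiableOn_id.mul (differentiableOn_besselLaplace (v - 1) one_pos))
      fun _ hl => mul_besselLaplace_one_ne_zero ha hl).const_mul _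
  have heq : EqOn (complexLaplace f) (fun l => w * besselRatio (v - 1) w l) {l | 0 < l.re} := by
    refine eqOn_re_pos_of_frequently hdiff hdr (l₀ := 1) (by simp) one_pos fun x hx => ?_
    have hx0 : 0 < x := by linarith
    rw [mul_one, complexLaplace_ofReal, hK x hx0, besselK_mul_sqrt_div (by linarith) hw0 hx0]
  obtain ⟨D, -, hD⟩ := exists_norm_besselRatio_le ha (show 1 < (1 + w) / 2 by linarith)
  rw [ofReal_eq_bromwichIntegral hf hf0 (hint 1 one_pos) (D := w * D) (fun l hl => ?_)
    hdiff.continuousOn ht, ← bromwichIntegral_const_mul]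
  · rw [bromwichIntegral, bromwichIntegral]
    congr 1
    ext ξ
    rw [heq (by simp [verticalLine_re])]
  · rw [heq (by simp only [mem_ofPred_eq]; linarith), norm_mul, Complex.norm_real,
      Real.norm_of_nonneg hw0.le, mul_div_assoc]
    gcongr
    exact (hD w (by linarith) l hl).1

theorem stmt_1 (d : ℕ) (hd : 2 ≤ d) (v : ℝ) (hv : v = ((d : ℝ) - 2)/2)
    (g : ℝ → ℝ → ℝ)
    (hcont : ContinuousOn (fun p : ℝ × ℝ => g p.1 p.2) (Set.Ioi 1 ×ˢ Set.Ici 0))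
    (hC2w : ∀ t > (0:ℝ), ContDiffOn ℝ 2 (fun w => g w t) (Set.Ioi 1))
    (hC1t : ∀ w > (1:ℝ), ContDiffOn ℝ 1 (fun t => g w t) (Set.Ioi 0))
    (hinit : ∀ w > (1:ℝ), g w 0 = 0)
    (hK : ∀ w > (1:ℝ), ∀ l > (0:ℝ),
      besselK v (Real.sqrt (2*l)) ≠ 0 ∧
      (∫ t in Set.Ioi (0:ℝ), Real.exp (-l*t) * g w t) =
        w ^ ((d : ℝ) - 1 - v) * besselK v (w * Real.sqrt (2*l)) /
          (l * besselK v (Real.sqrt (2*l))))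
    (hLexist : ∀ w > (1:ℝ), ∀ l > (0:ℝ),
      IntegrableOn (fun t => Real.exp (-l*t) * deriv (fun w' => g w' t) w) (Set.Ioi 0) ∧
      IntegrableOn (fun t => Real.exp (-l*t) * deriv (deriv (fun w' => g w' t)) w) (Set.Ioi 0) ∧
      IntegrableOn (fun t => Real.exp (-l*t) * deriv (fun t' => g w t') t) (Set.Ioi 0))
    (hLw : ∀ w > (1:ℝ), ∀ l > (0:ℝ),
      (∫ t in Set.Ioi (0:ℝ), Real.exp (-l*t) * deriv (fun w' => g w' t) w) =
        deriv (fun w' => ∫ t in Set.Ioi (0:ℝ), Real.exp (-l*t) * g w' t) w)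
    (hLww : ∀ w > (1:ℝ), ∀ l > (0:ℝ),
      (∫ t in Set.Ioi (0:ℝ), Real.exp (-l*t) * deriv (deriv (fun w' => g w' t)) w) =
        deriv (deriv (fun w' => ∫ t in Set.Ioi (0:ℝ), Real.exp (-l*t) * g w' t)) w)
    (hLt : ∀ w > (1:ℝ), ∀ l > (0:ℝ),
      (∫ t in Set.Ioi (0:ℝ), Real.exp (-l*t) * deriv (fun t' => g w t') t) =
        l * ∫ t in Set.Ioi (0:ℝ), Real.exp (-l*t) * g w t) :
    ∀ w > (1:ℝ), ∀ t > (0:ℝ),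
      deriv (fun t' => g w t') t =
        (1/2) * deriv (deriv (fun w' => g w' t)) w -
          (((d : ℝ) - 1)/(2*w)) * deriv (fun w' => g w' t) w +
          (((d : ℝ) - 1)/(2*w^2)) * g w t := by
  intro w hw t ht
  rcases hd.eq_or_lt with rfl | hd3
  · have hv0 : v = 0 := by rw [hv]; norm_num
    exact absurd (by rw [hv0]; exact besselK_zero_left (by norm_num)) (hK w hw 1 one_pos).1
  have hd3 : (3:ℝ) ≤ d := by exact_mod_cast hd3
  have hv2 : 1 / 2 ≤ v := by linarith
  set a := v - 1 with hadef
  have ha : 0 ≤ 2 * a + 1 := by linarith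
  have hg : ∀ w > (1:ℝ), ∀ t ≥ (0:ℝ),
      (g w t : ℂ) = w * bromwichIntegral (besselRatio a w) t := by
    intro w hw t ht
    refine ofReal_eq_mul_bromwichIntegral hv2 hw (f := g w) ?_ (hinit w hw)
      (fun l hl => (hK w hw l hl).1) (fun l hl => ?_) ht
    · exact hcont.comp (f := fun t : ℝ => (w, t)) (by fun_prop) fun t ht => ⟨hw, ht⟩
    · rw [(hK w hw l hl).2, show (d:ℝ) - 1 - v = 1 + v by linarith]
  have hre : ∀ w > (1:ℝ), ∀ t ≥ (0:ℝ),
      g w t = (w * bromwichIntegral (besselRatio a w) t).re := fun w hw t ht => by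
    rw [← hg w hw t ht, Complex.ofReal_re]
  have hofReal (w : ℝ) : HasDerivAt (fun w : ℝ => (w : ℂ)) 1 w := Complex.ofRealCLM.hasDerivAt
  have hdt : HasDerivAt (fun t' => g w t')
      (w * bromwichIntegral (fun l => l * besselRatio a w l) t).re t := by
    refine HasDerivAt.congr_of_eventuallyEq (Complex.reCLM.hasFDerivAt.comp_hasDerivAt t
      ((hasDerivAt_bromwichIntegral_besselRatio_time ha hw t).const_mul (w : ℂ))) ?_
    filter_upwards [Ioi_mem_nhds ht] with s hs
    exact hre w hw s (le_of_lt hs)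
  have hdw : ∀ w > (1:ℝ), HasDerivAt (fun w' => g w' t)
      (bromwichIntegral (besselRatio a w) t + w * bromwichIntegral (besselRatioDeriv a w) t).re
      w := by
    intro w hw
    have h := (hofReal w).mul (hasDerivAt_bromwichIntegral_besselRatio ha hw t)
    rw [one_mul] at h
    refine HasDerivAt.congr_of_eventuallyEq (Complex.reCLM.hasFDerivAt.comp_hasDerivAt w h) ?_
    filter_upwards [Ioi_mem_nhds hw] with s hs
    exact hre s hs t ht.le
  have hdww : HasDerivAt (deriv fun w' => g w' t)
      (2 * bromwichIntegral (besselRatioDeriv a w) t +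
        w * (2 * bromwichIntegral (fun l => l * besselRatio a w l) t +
          (2 * a + 1 : ℝ) / w * bromwichIntegral (besselRatioDeriv a w) t)).re w := by
    have h := (hasDerivAt_bromwichIntegral_besselRatio ha hw t).add
      ((hofReal w).mul (hasDerivAt_bromwichIntegral_besselRatioDeriv ha hw t))
    rw [one_mul, ← add_assoc, ← two_mul] at h
    refine HasDerivAt.congr_of_eventuallyEq (Complex.reCLM.hasFDerivAt.comp_hasDerivAt w h) ?_
    filter_upwards [Ioi_mem_nhds hw] with s hs
    exact (hdw s hs).deriv
  have hw0 : w ≠ 0 := by linarith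
  have hda : (d : ℝ) = 2 * a + 4 := by linarith
  rw [hdt.deriv, (hdw w hw).deriv, hdww.deriv, hre w hw t ht.le, hda]
  simp only [← Complex.ofReal_div, Complex.add_re, Complex.re_ofReal_mul, ← Complex.ofReal_ofNat]
  field_simp
  ring
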